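/- arXiv:1503.06286 — 3 statements merged into one kernel-verified Lean document; each statement's English description precedes it below -/
import Mathlib

section
/- If G is a connected 3-regular finite simple graph whose second largest adjacency eigenvalue satisfies λ₂(G) > 1, then λ₂(G) ≥ √2. -/
open Polynomial

/-- The adjacency matrix of a simple graph over `ℝ` is Hermitian. -/
theorem adjMatrix_isHermitian {V : Type*} [Fintype V] [DecidableEq V]
    (G : SimpleGraph V) [DecidableRel G.Adj] : (G.adjMatrix ℝ).IsHermitian := by
  rw [Matrix.IsHermitian, Matrix.conjTranspose_eq_transpose_of_trivial]
  exact G.isSymm_adjMatrix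

/-- The multiset of adjacency eigenvalues (with multiplicity) of a finite simple graph. -/
noncomputable def eigMultiset {V : Type*} [Fintype V] [DecidableEq V]
    (G : SimpleGraph V) [DecidableRel G.Adj] : Multiset ℝ :=
  Multiset.map (adjMatrix_isHermitian G).eigenvalues Finset.univ.val

/-- The second largest adjacency eigenvalue (with multiplicity) of a finite simple graph:
the second-to-last entry of the nondecreasing sorted list of eigenvalues. -/
noncomputable def secondEigenvalue {V : Type*} [Fintype V] [DecidableEq V]
    (G : SimpleGraph V) [DecidableRel G.Adj] : ℝ :=
  ((eigMultiset G).sort (· ≤ ·)).getD (((eigMultiset G).sort (· ≤ ·)).length - 2) 0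

/-- The largest adjacency eigenvalue (spectral radius) of a finite simple graph. -/
noncomputable def largestEigenvalue {V : Type*} [Fintype V] [DecidableEq V]
    (G : SimpleGraph V) [DecidableRel G.Adj] : ℝ :=
  ((eigMultiset G).sort (· ≤ ·)).getD (((eigMultiset G).sort (· ≤ ·)).length - 1) 0

/-- The orthogonal polynomials `F_i^{(k)}`. -/
noncomputable def Fpoly (k : ℕ) : ℕ → Polynomial ℝ
  | 0 => 1
  | 1 => X
  | 2 => X ^ 2 - C (k : ℝ)
  | n + 3 => X * Fpoly k (n + 2) - C ((k : ℝ) - 1) * Fpoly k (n + 1)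

/-- `G_i = Σ_{j=0}^i F_j`. -/
noncomputable def Gpoly (k : ℕ) (i : ℕ) : Polynomial ℝ :=
  ∑ j ∈ Finset.range (i + 1), Fpoly k j

/-- The tridiagonal matrix `T(k,t,c)`: superdiagonal `(k, k-1, …, k-1)`,
subdiagonal `(1, …, 1, c)`, diagonal chosen so that every row sums to `k`. -/
noncomputable def Tmat (k t : ℕ) (c : ℝ) : Matrix (Fin t) (Fin t) ℝ :=
  Matrix.of fun i j =>
    if (j : ℕ) = (i : ℕ) + 1 then (if (i : ℕ) = 0 then (k : ℝ) else (k : ℝ) - 1)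
    else if (i : ℕ) = (j : ℕ) + 1 then (if (i : ℕ) = t - 1 then c else 1)
    else if i = j then
      (k : ℝ) - (if (i : ℕ) + 1 < t then (if (i : ℕ) = 0 then (k : ℝ) else (k : ℝ) - 1) else 0)
        - (if 0 < (i : ℕ) then (if (i : ℕ) = t - 1 then c else 1) else 0)
    else 0

/-- `M(k,t,c) = 1 + Σ_{i=0}^{t-3} k (k-1)^i + k (k-1)^{t-2} / c`. -/
noncomputable def Mbound (k t : ℕ) (c : ℝ) : ℝ :=
  1 + (∑ i ∈ Finset.range (t - 2), (k : ℝ) * ((k : ℝ) - 1) ^ i)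
    + (k : ℝ) * ((k : ℝ) - 1) ^ (t - 2) / c

section Spectral

variable {V : Type*} [Fintype V] [DecidableEq V] (G : SimpleGraph V) [DecidableRel G.Adj]

/-- All adjacency eigenvalues but one are at most `secondEigenvalue`, which is attained among
them. -/
theorem exists_index_secondEigenvalue (hcard : 2 ≤ Fintype.card V) :
    ∃ i₀ i₁ : V, i₀ ≠ i₁ ∧ (adjMatrix_isHermitian G).eigenvalues i₁ = secondEigenvalue G ∧
      ∀ i, i ≠ i₀ → (adjMatrix_isHermitian G).eigenvalues i ≤ secondEigenvalue G := by
  set hA := adjMatrix_isHermitian G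
  set e : Fin (Fintype.card V) ≃ V := Fintype.equivOfCardEq (Fintype.card_fin _) with he
  have hev : ∀ k, hA.eigenvalues (e k) = hA.eigenvalues₀ k := fun k ↦ by
    simp [Matrix.IsHermitian.eigenvalues, he]
  have hsort : (eigMultiset G).sort (· ≤ ·) =
      List.ofFn fun k : Fin (Fintype.card V) ↦ hA.eigenvalues₀ k.rev := by
    refine List.Perm.eq_of_pairwise' (r := (· ≤ ·)) (Multiset.pairwise_sort _ _) ?_ ?_
    · rw [List.pairwise_ofFn]
      exact fun i j hij ↦ hA.eigenvalues₀_antitone (Fin.rev_le_rev.2 hij.le)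
    · rw [← Multiset.coe_eq_coe, Multiset.sort_eq]
      have h1 : (List.ofFn fun k : Fin (Fintype.card V) ↦ hA.eigenvalues₀ k.rev) =
          (List.finRange _).map fun k ↦ hA.eigenvalues (e k.rev) := by
        simp [List.ofFn_eq_map, hev]
      have h2 : (Finset.univ : Finset V).val =
          (Finset.univ : Finset (Fin (Fintype.card V))).val.map (Fin.revPerm.trans e) := by
        rw [← Finset.map_univ_equiv (Fin.revPerm.trans e)]
        rfl
      rw [h1, eigMultiset, h2, Multiset.map_map]
      rfl
  have hsecond : secondEigenvalue G = hA.eigenvalues₀ ⟨1, hcard⟩ := by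
    rw [secondEigenvalue, hsort, List.getD_eq_getElem _ _ (by simp; omega)]
    simp only [List.getElem_ofFn]
    congr 1
    ext
    simp
    omega
  refine ⟨e ⟨0, by omega⟩, e ⟨1, hcard⟩, ?_, ?_, ?_⟩
  · simp
  · rw [hev, hsecond]
  · intro i hi
    obtain ⟨k, rfl⟩ := e.surjective i
    rw [hev, hsecond]
    refine hA.eigenvalues₀_antitone ?_
    have : k ≠ ⟨0, by omega⟩ := fun h ↦ hi (by rw [h])
    rw [Fin.le_def]
    have := Fin.val_ne_of_ne this
    simp only at this ⊢
    omega

variable {G}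

omit [DecidableEq V] in
theorem sum_sum_neighborFinset_comm {M : Type*} [AddCommMonoid M] (F : V → V → M) :
    ∑ u, ∑ w ∈ G.neighborFinset u, F u w = ∑ w, ∑ u ∈ G.neighborFinset w, F u w :=
  Finset.sum_comm' fun u w ↦ by simp [G.adj_comm]

omit [DecidableEq V] in
theorem sum_sum_neighborFinset_of_isRegularOfDegree {d : ℕ} (hreg : G.IsRegularOfDegree d)
    (f : V → ℝ) : ∑ u, ∑ w ∈ G.neighborFinset u, f w = d * ∑ u, f u := by
  rw [sum_sum_neighborFinset_comm, Finset.mul_sum]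
  simp [hreg.degree_eq]

omit [DecidableEq V] in
/-- An eigenfunction of a regular graph whose eigenvalue is not the degree has mean zero. -/
theorem sum_eq_zero_of_eigenfunction {d : ℕ} (hreg : G.IsRegularOfDegree d) {f : V → ℝ} {μ : ℝ}
    (hμ : μ ≠ d) (hf : ∀ u, ∑ w ∈ G.neighborFinset u, f w = μ * f u) : ∑ u, f u = 0 := by
  have h := sum_sum_neighborFinset_of_isRegularOfDegree hreg f
  simp only [hf, ← Finset.mul_sum] at h
  by_contra h0
  exact hμ (mul_right_cancel₀ h0 h)

theorem eigenvectorBasis_eigenfunction (i u : V) :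
    ∑ w ∈ G.neighborFinset u, (adjMatrix_isHermitian G).eigenvectorBasis i w =
      (adjMatrix_isHermitian G).eigenvalues i * (adjMatrix_isHermitian G).eigenvectorBasis i u := by
  have h := congrFun ((adjMatrix_isHermitian G).mulVec_eigenvectorBasis i) u
  rwa [G.adjMatrix_mulVec_apply] at h

theorem exists_eigenfunction_secondEigenvalue {d : ℕ} (hreg : G.IsRegularOfDegree d)
    (hcard : 2 ≤ Fintype.card V) (hlt : secondEigenvalue G < d) :
    ∃ f : V → ℝ, f ≠ 0 ∧ ∑ u, f u = 0 ∧
      ∀ u, ∑ w ∈ G.neighborFinset u, f w = secondEigenvalue G * f u := by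
  obtain ⟨-, i, -, hi, -⟩ := exists_index_secondEigenvalue G hcard
  have hf := eigenvectorBasis_eigenfunction (G := G) i
  rw [hi] at hf
  refine ⟨_, fun h0 ↦ ?_, sum_eq_zero_of_eigenfunction hreg hlt.ne hf, hf⟩
  have := (adjMatrix_isHermitian G).eigenvectorBasis.orthonormal.ne_zero i
  exact this (by ext u; exact congrFun h0 u)

/-- The Rayleigh quotient of a mean-zero function is a lower bound for the second eigenvalue. -/
theorem le_secondEigenvalue_of_sum_eq_zero {d : ℕ} (hreg : G.IsRegularOfDegree d)
    (hcard : 2 ≤ Fintype.card V) {c : ℝ} (hc : c ≤ d) {f : V → ℝ} (hf0 : f ≠ 0)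
    (hsum : ∑ u, f u = 0)
    (hf : c * ∑ u, f u ^ 2 ≤ ∑ u, f u * ∑ w ∈ G.neighborFinset u, f w) :
    c ≤ secondEigenvalue G := by
  by_contra! hlt
  obtain ⟨i₀, -, -, -, hi₀⟩ := exists_index_secondEigenvalue G hcard
  set hA := adjMatrix_isHermitian G
  set b := hA.eigenvectorBasis
  have hone : ∀ i, i ≠ i₀ → ∑ u, b i u = 0 := fun i hi ↦
    sum_eq_zero_of_eigenfunction hreg ((hi₀ i hi).trans_lt (hlt.trans_le hc)).ne
      (eigenvectorBasis_eigenfunction i)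
  set F : EuclideanSpace ℝ V := WithLp.toLp 2 f with hF
  set J : EuclideanSpace ℝ V := WithLp.toLp 2 fun _ ↦ 1 with hJ
  have hinner : ∀ x y : EuclideanSpace ℝ V, inner ℝ x y = ∑ u, x u * y u := fun x y ↦ by
    simp [PiLp.inner_apply, mul_comm]
  have hcoord : ∀ x y, inner ℝ x y = ∑ i, inner ℝ (b i) x * inner ℝ (b i) y := fun x y ↦ by
    rw [← b.sum_inner_mul_inner x y]
    exact Finset.sum_congr rfl fun i _ ↦ by rw [real_inner_comm]
  have hJb : ∀ i, i ≠ i₀ → inner ℝ (b i) J = 0 := fun i hi ↦ by simp [hinner, hJ, hone i hi]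
  have hFb : inner ℝ (b i₀) F = 0 := by
    have hJF : inner ℝ J F = 0 := by simp [hinner, hJ, hF, hsum]
    have hJJ : inner ℝ J J ≠ 0 := by
      simp only [hinner, hJ]
      simp
      omega
    rw [hcoord, Finset.sum_eq_single i₀ (fun i _ hi ↦ by simp [hJb i hi]) (by simp)] at hJF hJJ
    exact (mul_eq_zero.1 hJF).resolve_left fun h ↦ hJJ (by simp [h])
  have hAb : ∀ i, inner ℝ (b i) (WithLp.toLp 2 fun u ↦ ∑ w ∈ G.neighborFinset u, f w) =
      hA.eigenvalues i * inner ℝ (b i) F := fun i ↦ by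
    simp only [hinner, hF, Finset.mul_sum]
    rw [sum_sum_neighborFinset_comm]
    refine Finset.sum_congr rfl fun u _ ↦ ?_
    rw [← Finset.sum_mul, eigenvectorBasis_eigenfunction, mul_assoc]
  have h1 : ∑ u, f u ^ 2 = ∑ i, inner ℝ (b i) F ^ 2 := by
    have := hcoord F F
    rw [hinner] at this
    simpa only [sq] using this
  have h2 : ∑ u, f u * ∑ w ∈ G.neighborFinset u, f w =
      ∑ i, hA.eigenvalues i * inner ℝ (b i) F ^ 2 := by
    have := hcoord F (WithLp.toLp 2 fun u ↦ ∑ w ∈ G.neighborFinset u, f w)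
    rw [hinner] at this
    simp only [hAb] at this
    rw [show ∑ u, f u * ∑ w ∈ G.neighborFinset u, f w = _ from this]
    exact Finset.sum_congr rfl fun i _ ↦ by ring
  have h3 : ∑ i, hA.eigenvalues i * inner ℝ (b i) F ^ 2 ≤
      secondEigenvalue G * ∑ i, inner ℝ (b i) F ^ 2 := by
    rw [Finset.mul_sum]
    refine Finset.sum_le_sum fun i _ ↦ ?_
    by_cases hi : i = i₀
    · simp [hi, hFb]
    · exact mul_le_mul_of_nonneg_right (hi₀ i hi) (sq_nonneg _)
  obtain ⟨v, hv⟩ := Function.ne_iff.1 hf0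
  have h4 : 0 < ∑ u, f u ^ 2 :=
    Finset.sum_pos' (fun u _ ↦ sq_nonneg _) ⟨v, Finset.mem_univ _, sq_pos_of_ne_zero hv⟩
  rw [← h2, ← h1] at h3
  nlinarith

/-- A form of `le_secondEigenvalue_of_sum_eq_zero` for functions that need not have mean zero. -/
theorem le_secondEigenvalue_of_rayleigh {d : ℕ} (hreg : G.IsRegularOfDegree d)
    (hcard : 2 ≤ Fintype.card V) {c : ℝ} (hc : c ≤ d) {f : V → ℝ}
    (hpos : (∑ u, f u) ^ 2 < Fintype.card V * ∑ u, f u ^ 2)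
    (hf : c * (Fintype.card V * ∑ u, f u ^ 2 - (∑ u, f u) ^ 2) ≤
      Fintype.card V * (∑ u, f u * ∑ w ∈ G.neighborFinset u, f w) - d * (∑ u, f u) ^ 2) :
    c ≤ secondEigenvalue G := by
  set n : ℝ := (Fintype.card V : ℝ) with hn
  set s : ℝ := ∑ u, f u with hs
  set q : ℝ := ∑ u, f u ^ 2 with hq
  set r : ℝ := ∑ u, f u * ∑ w ∈ G.neighborFinset u, f w with hr
  have hn0 : 0 < n := by rw [hn]; exact_mod_cast (by omega : 0 < Fintype.card V)
  have e2 : ∑ u, (n * f u - s) ^ 2 = n * (n * q - s ^ 2) := by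
    have : ∀ u, (n * f u - s) ^ 2 = n ^ 2 * f u ^ 2 - 2 * n * s * f u + s ^ 2 := fun u ↦ by ring
    simp only [this, Finset.sum_add_distrib, Finset.sum_sub_distrib, ← Finset.mul_sum,
      Finset.sum_const, Finset.card_univ, nsmul_eq_mul, ← hn, ← hs, ← hq]
    ring
  have e3 : ∑ u, (n * f u - s) * ∑ w ∈ G.neighborFinset u, (n * f w - s) =
      n * (n * r - d * s ^ 2) := by
    have h1 : ∀ u, ∑ w ∈ G.neighborFinset u, (n * f w - s) =
        n * ∑ w ∈ G.neighborFinset u, f w - d * s := fun u ↦ by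
      simp [Finset.sum_sub_distrib, Finset.mul_sum, hreg.degree_eq]
    have h2 : ∀ u, (n * f u - s) * (n * ∑ w ∈ G.neighborFinset u, f w - d * s) =
        n ^ 2 * (f u * ∑ w ∈ G.neighborFinset u, f w) - n * d * s * f u
          - n * s * ∑ w ∈ G.neighborFinset u, f w + d * s ^ 2 := fun u ↦ by ring
    simp only [h1, h2, Finset.sum_add_distrib, Finset.sum_sub_distrib, ← Finset.mul_sum,
      Finset.sum_const, Finset.card_univ, nsmul_eq_mul, ← hn, ← hs, ← hr,
      sum_sum_neighborFinset_of_isRegularOfDegree hreg]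
    ring
  refine le_secondEigenvalue_of_sum_eq_zero hreg hcard hc (f := fun u ↦ n * f u - s) ?_ ?_ ?_
  · intro h0
    have : ∑ u, (n * f u - s) ^ 2 = 0 :=
      Finset.sum_eq_zero fun u _ ↦ by simpa using congrFun h0 u
    rw [e2] at this
    rcases mul_eq_zero.1 this with h | h <;> linarith
  · rw [Finset.sum_sub_distrib, ← Finset.mul_sum]
    simp [← hn, ← hs]
  · rw [e2, e3]
    nlinarith

end Spectral

section Cubic

open Finset

variable {V : Type*} [Fintype V] [DecidableEq V] {G : SimpleGraph V} [DecidableRel G.Adj]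

theorem sqrt_two_le_seventeen_div_twelve : √2 ≤ 17 / 12 :=
  (Real.sqrt_le_left (by norm_num)).2 (by norm_num)

theorem card_sdiff_neighborFinset_le {d : ℕ} (hreg : G.IsRegularOfDegree d) {s : Finset V} {u a : V}
    (ha : a ∈ s) (hua : G.Adj u a) : #(G.neighborFinset u \ s) ≤ d - 1 := by
  have h : G.neighborFinset u \ s ⊆ (G.neighborFinset u).erase a := fun w hw ↦ by
    rw [mem_sdiff] at hw
    exact mem_erase.2 ⟨fun h ↦ hw.2 (h ▸ ha), hw.1⟩
  refine (card_le_card h).trans ?_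
  rw [card_erase_of_mem (by simpa using hua), G.card_neighborFinset_eq_degree, hreg.degree_eq]

/-- A small set inducing minimum degree two, such as a short cycle, forces a large second
eigenvalue. -/
theorem sqrt_two_le_of_minDegree_two (hreg : G.IsRegularOfDegree 3) {C : Finset V}
    (h3 : 3 ≤ #C) (h5 : #C ≤ 5)
    (hC : ∀ c ∈ C, ∃ a ∈ C, ∃ b ∈ C, a ≠ b ∧ G.Adj c a ∧ G.Adj c b)
    (hn : 2 * #C + 2 ≤ Fintype.card V) : √2 ≤ secondEigenvalue G := by
  have hbd : ∀ c ∈ C, #(G.neighborFinset c \ C) ≤ 1 := fun c hc ↦ by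
    obtain ⟨a, ha, b, hb, hab, hca, hcb⟩ := hC c hc
    have h : G.neighborFinset c \ C ⊆ ((G.neighborFinset c).erase a).erase b := fun w hw ↦ by
      rw [mem_sdiff] at hw
      exact mem_erase.2 ⟨fun h ↦ hw.2 (h ▸ hb), mem_erase.2 ⟨fun h ↦ hw.2 (h ▸ ha), hw.1⟩⟩
    refine (card_le_card h).trans ?_
    rw [card_erase_of_mem (mem_erase.2 ⟨hab.symm, by simpa using hcb⟩),
      card_erase_of_mem (by simpa using hca), G.card_neighborFinset_eq_degree, hreg.degree_eq]
  set W := C ∪ C.biUnion fun c ↦ G.neighborFinset c \ C with hW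
  have hWc : #W ≤ #C + #C * 1 :=
    (card_union_le _ _).trans (Nat.add_le_add_left (card_biUnion_le_card_mul _ _ _ hbd) _)
  obtain ⟨p, hp, q, hq, hpq⟩ := one_lt_card.1 (show 1 < #Wᶜ by rw [card_compl]; omega)
  set R : Finset V := {p, q} with hR
  have hRW : ∀ r ∈ R, r ∉ W := by
    intro r hr
    rcases mem_insert.1 hr with rfl | hr
    · exact mem_compl.1 hp
    · rw [mem_singleton.1 hr]; exact mem_compl.1 hq
  have hRC : ∀ r ∈ R, r ∉ C := fun r hr h ↦ hRW r hr (mem_union_left _ h)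
  have hnadj : ∀ r ∈ R, ∀ c ∈ C, ¬ G.Adj c r := fun r hr c hc h ↦
    hRW r hr (mem_union_right _ (mem_biUnion.2 ⟨c, hc, mem_sdiff.2 ⟨by simpa, hRC r hr⟩⟩))
  have hRcard : #R = 2 := card_pair hpq
  set f : V → ℝ := fun u ↦ 2 * (if u ∈ C then 1 else 0) - (if u ∈ R then 1 else 0) with hf
  have hsum : ∑ u, f u = 2 * #C - 2 := by
    simp only [hf, sum_sub_distrib, ← mul_sum, sum_ite_mem, univ_inter]
    simp [hRcard]
  have hsq : ∑ u, f u ^ 2 = 4 * #C + 2 := by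
    have : ∀ u, f u ^ 2 = 4 * (if u ∈ C then 1 else 0) + (if u ∈ R then 1 else 0) := fun u ↦ by
      by_cases h1 : u ∈ C <;> by_cases h2 : u ∈ R <;> simp [hf, h1, h2]
      · exact absurd h1 (hRC u h2)
      · norm_num
    simp only [this, sum_add_distrib, ← mul_sum, sum_ite_mem, univ_inter]
    simp [hRcard]
  have hray : 8 * (#C : ℝ) ≤ ∑ u, f u * ∑ w ∈ G.neighborFinset u, f w := by
    have : 8 * (#C : ℝ) = ∑ u, 8 * (if u ∈ C then 1 else 0) := by
      rw [← mul_sum, sum_ite_mem, univ_inter]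
      simp
    rw [this]
    refine sum_le_sum fun u _ ↦ ?_
    by_cases h1 : u ∈ C
    · have hfu : f u = 2 := by simp [hf, h1, show u ∉ R from fun h ↦ hRC u h h1]
      obtain ⟨a, ha, b, hb, hab, hua, hub⟩ := hC u h1
      have h2 : ∑ w ∈ {a, b}, f w ≤ ∑ w ∈ G.neighborFinset u, f w := by
        refine sum_le_sum_of_subset_of_nonneg ?_ fun w hw _ ↦ ?_
        · intro w hw
          rcases mem_insert.1 hw with rfl | hw
          · simpa
          · rw [mem_singleton.1 hw]; simpa
        · have : w ∉ R := fun h ↦ hnadj w h u h1 (by simpa using hw)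
          by_cases hwC : w ∈ C <;> simp [hf, this, hwC]
      rw [sum_pair hab] at h2
      have hfa : f a = 2 := by simp [hf, ha, show a ∉ R from fun h ↦ hRC a h ha]
      have hfb : f b = 2 := by simp [hf, hb, show b ∉ R from fun h ↦ hRC b h hb]
      rw [hfa, hfb] at h2
      rw [hfu]
      simp only [h1]
      norm_num
      linarith
    · by_cases h2 : u ∈ R
      · have h3 : ∑ w ∈ G.neighborFinset u, f w ≤ 0 := by
          refine sum_nonpos fun w hw ↦ ?_
          have : w ∉ C := fun h ↦ hnadj u h2 w h (by simpa [G.adj_comm] using hw)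
          by_cases hwR : w ∈ R <;> simp [hf, this, hwR]
        simp only [hf, h1, h2] at h3 ⊢
        norm_num at h3 ⊢
        linarith
      · simp [hf, h1, h2]
  have hn' : (2 * #C + 2 : ℝ) ≤ Fintype.card V := by exact_mod_cast hn
  have hs := sqrt_two_le_seventeen_div_twelve
  have hs0 : 0 ≤ √2 := Real.sqrt_nonneg 2
  refine le_secondEigenvalue_of_rayleigh hreg (by omega) (by push_cast; linarith) (f := f) ?_ ?_
  · rw [hsum, hsq]
    generalize #C = g at *
    interval_cases g <;> push_cast at * <;> linarith
  · rw [hsum, hsq]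
    have h1 := mul_le_mul_of_nonneg_left hray (Nat.cast_nonneg (α := ℝ) (Fintype.card V))
    generalize (Fintype.card V : ℝ) = n at *
    generalize #C = g at *
    refine le_trans (b := 17 / 12 * (n * (4 * g + 2) - (2 * g - 2) ^ 2))
      (mul_le_mul_of_nonneg_right hs ?_) ?_ <;>
    interval_cases g <;> push_cast at * <;> linarith

/-- The Perron vector of a path of length two with middle vertex `v` and ends `a`, `b`. -/
noncomputable def pathVector (v a b : V) (u : V) : ℝ :=
  (if u = v then √2 else 0) + (if u = a then 1 else 0) + (if u = b then 1 else 0)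

omit [Fintype V] in
theorem pathVector_nonneg (v a b u : V) : 0 ≤ pathVector v a b u := by
  unfold pathVector
  positivity

theorem sum_pathVector (v a b : V) : ∑ u, pathVector v a b u = √2 + 2 := by
  simp only [pathVector, sum_add_distrib, sum_ite_eq', mem_univ, if_true]
  ring

omit [Fintype V] in
theorem pathVector_eq_zero {v a b u : V} (hv : u ≠ v) (ha : u ≠ a) (hb : u ≠ b) :
    pathVector v a b u = 0 := by
  simp [pathVector, hv, ha, hb]

theorem sqrt_two_mul_pathVector_le {v a b : V} (hab : a ≠ b) (ha : G.Adj v a) (hb : G.Adj v b)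
    (u : V) :
    √2 * pathVector v a b u ≤ ∑ w ∈ G.neighborFinset u, pathVector v a b w := by
  have h : ∑ w ∈ G.neighborFinset u, pathVector v a b w =
      (if G.Adj u v then √2 else 0) + (if G.Adj u a then 1 else 0)
        + (if G.Adj u b then 1 else 0) := by
    simp [pathVector, sum_add_distrib, sum_ite_eq']
  have hs : √2 * √2 = 2 := Real.mul_self_sqrt (by norm_num)
  rw [h]
  by_cases hv : u = v
  · subst hv
    simp [pathVector, ha, hb, ha.ne, hb.ne, hs]
    norm_num
  · by_cases hua : u = a
    · subst hua
      simp only [pathVector, hv, hab, ha.symm]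
      split_ifs <;> simp_all
    · by_cases hub : u = b
      · subst hub
        simp only [pathVector, hv, hua, hb.symm]
        split_ifs <;> simp_all
      · rw [pathVector_eq_zero hv hua hub, mul_zero]
        positivity

/-- Two paths of length two with no edge between them force a large second eigenvalue. -/
theorem sqrt_two_le_of_two_paths (hreg : G.IsRegularOfDegree 3) {v a b v' a' b' : V}
    (hab : a ≠ b) (ha : G.Adj v a) (hb : G.Adj v b)
    (hab' : a' ≠ b') (ha' : G.Adj v' a') (hb' : G.Adj v' b')
    (hsep : ∀ x ∈ ({v, a, b} : Finset V), ∀ y ∈ ({v', a', b'} : Finset V), x ≠ y ∧ ¬ G.Adj x y) :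
    √2 ≤ secondEigenvalue G := by
  set g := pathVector v a b with hg
  set h := pathVector v' a' b' with hh
  have hs := sqrt_two_le_seventeen_div_twelve
  have hg0 : ∀ u, u ∉ ({v, a, b} : Finset V) → g u = 0 := fun u hu ↦ by
    simp only [mem_insert, mem_singleton, not_or] at hu
    exact pathVector_eq_zero hu.1 hu.2.1 hu.2.2
  have hh0 : ∀ u, u ∉ ({v', a', b'} : Finset V) → h u = 0 := fun u hu ↦ by
    simp only [mem_insert, mem_singleton, not_or] at hu
    exact pathVector_eq_zero hu.1 hu.2.1 hu.2.2
  have hgh : ∀ u, g u * h u = 0 := fun u ↦ by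
    by_cases hu : u ∈ ({v, a, b} : Finset V)
    · rw [hh0 u fun hu' ↦ (hsep u hu u hu').1 rfl, mul_zero]
    · rw [hg0 u hu, zero_mul]
  have hgh' : ∀ u w, G.Adj u w → g u * h w = 0 := fun u w huw ↦ by
    by_cases hu : u ∈ ({v, a, b} : Finset V)
    · rw [hh0 w fun hw ↦ (hsep u hu w hw).2 huw, mul_zero]
    · rw [hg0 u hu, zero_mul]
  have hcard : 2 ≤ Fintype.card V := by
    have := Fintype.one_lt_card_iff.2 ⟨a, b, hab⟩
    omega
  refine le_secondEigenvalue_of_sum_eq_zero hreg hcard (by push_cast; linarith)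
    (f := fun u ↦ g u - h u) ?_ ?_ ?_
  · intro h0
    have h1 : g v - h v = 0 := congrFun h0 v
    have h2 : h v = 0 := hh0 v fun hv ↦ (hsep v (by simp) v hv).1 rfl
    have h3 : g v = √2 := by simp [hg, pathVector, ha.ne, hb.ne]
    have : 0 < √2 := by positivity
    linarith
  · rw [sum_sub_distrib, sum_pathVector, sum_pathVector, sub_self]
  · rw [mul_sum]
    refine sum_le_sum fun u _ ↦ ?_
    have e1 : g u * ∑ w ∈ G.neighborFinset u, h w = 0 := by
      rw [mul_sum]
      exact sum_eq_zero fun w hw ↦ hgh' u w (by simpa using hw)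
    have e2 : h u * ∑ w ∈ G.neighborFinset u, g w = 0 := by
      rw [mul_sum]
      exact sum_eq_zero fun w hw ↦ by
        rw [mul_comm]
        exact hgh' w u (by simpa [G.adj_comm] using hw)
    have e3 := mul_le_mul_of_nonneg_left (sqrt_two_mul_pathVector_le (G := G) hab ha hb u)
      (pathVector_nonneg v a b u)
    have e4 := mul_le_mul_of_nonneg_left (sqrt_two_mul_pathVector_le (G := G) hab' ha' hb' u)
      (pathVector_nonneg v' a' b' u)
    rw [← hg] at e3
    rw [← hh] at e4
    have e5 : √2 * (g u - h u) ^ 2 = g u * (√2 * g u) + h u * (√2 * h u) := by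
      linear_combination (-2 * √2) * hgh u
    rw [sum_sub_distrib, e5]
    linarith

/-- A cubic graph on at least fourteen vertices contains two paths of length two with no edge
between them. -/
theorem sqrt_two_le_of_fourteen_le_card (hreg : G.IsRegularOfDegree 3)
    (hn : 14 ≤ Fintype.card V) : √2 ≤ secondEigenvalue G := by
  have hN : ∀ u, #(G.neighborFinset u) = 3 := fun u ↦ by
    rw [G.card_neighborFinset_eq_degree, hreg.degree_eq]
  obtain ⟨v⟩ : Nonempty V := Fintype.card_pos_iff.1 (by omega)
  obtain ⟨a, b, c, hab, -, -, hv⟩ := card_eq_three.1 (hN v)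
  have ha : G.Adj v a := by rw [← G.mem_neighborFinset, hv]; simp
  have hb : G.Adj v b := by rw [← G.mem_neighborFinset, hv]; simp
  set P : Finset V := {v, a, b} with hP
  have hPc : #P = 3 := card_eq_three.2 ⟨v, a, b, ha.ne, hb.ne, hab, rfl⟩
  set S := P.biUnion fun p ↦ G.neighborFinset p \ P with hS
  have hSc : #S ≤ 5 := by
    have h1 : G.neighborFinset v \ P ⊆ {c} := fun w hw ↦ by
      rw [hv] at hw
      simp only [hP, mem_sdiff, mem_insert, mem_singleton] at hw ⊢
      tauto
    have h2 := card_sdiff_neighborFinset_le hreg (s := P) (by simp [hP]) ha.symm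
    have h3 := card_sdiff_neighborFinset_le hreg (s := P) (by simp [hP]) hb.symm
    have h4 := card_le_card h1
    rw [card_singleton] at h4
    rw [hS, hP, biUnion_insert, biUnion_insert, singleton_biUnion, ← hP]
    refine (card_union_le _ _).trans ?_
    have := card_union_le (G.neighborFinset a \ P) (G.neighborFinset b \ P)
    omega
  set R := (P ∪ S)ᶜ with hR
  have hRc : 6 ≤ #R := by
    have := card_union_le P S
    rw [hR, card_compl]
    omega
  have hPR : ∀ p ∈ P, ∀ r ∈ R, p ≠ r ∧ ¬ G.Adj p r := fun p hp r hr ↦ by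
    rw [hR, mem_compl, mem_union, not_or] at hr
    refine ⟨fun h ↦ hr.1 (h ▸ hp), fun h ↦ hr.2 (mem_biUnion.2 ⟨p, hp, ?_⟩)⟩
    exact mem_sdiff.2 ⟨by simpa, hr.1⟩
  by_cases hex : ∃ r ∈ R, 1 < #(G.neighborFinset r ∩ R)
  · obtain ⟨v', hv', h⟩ := hex
    obtain ⟨a', ha', b', hb', hab'⟩ := one_lt_card.1 h
    simp only [mem_inter, G.mem_neighborFinset] at ha' hb'
    refine sqrt_two_le_of_two_paths hreg hab ha hb hab' ha'.1 hb'.1 fun x hx y hy ↦ hPR x hx y ?_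
    simp only [mem_insert, mem_singleton] at hy
    rcases hy with rfl | rfl | rfl
    exacts [hv', ha'.2, hb'.2]
  · push Not at hex
    have h1 : #R * 2 ≤ #S * 2 := by
      refine card_mul_le_card_mul G.Adj (fun r hr ↦ ?_) fun s hs ↦ ?_
      · have h2 : G.neighborFinset r ⊆ (G.neighborFinset r ∩ R) ∪ S.bipartiteAbove G.Adj r := by
          intro w hw
          rw [mem_union, mem_inter, mem_bipartiteAbove]
          have hrw : G.Adj r w := by simpa using hw
          have hwP : w ∉ P := fun h ↦ (hPR w h r hr).2 hrw.symm
          by_cases hwS : w ∈ S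
          · exact .inr ⟨hwS, hrw⟩
          · exact .inl ⟨hw, by rw [hR, mem_compl, mem_union]; tauto⟩
        have := (card_le_card h2).trans (card_union_le _ _)
        have := hex r hr
        rw [hN] at *
        omega
      · obtain ⟨p, hp, hps⟩ := mem_biUnion.1 hs
        have hsp : G.Adj s p := by
          rw [G.adj_comm]
          simpa using (mem_sdiff.1 hps).1
        refine (card_le_card fun w hw ↦ ?_).trans (card_sdiff_neighborFinset_le hreg hp hsp)
        rw [mem_bipartiteBelow] at hw
        exact mem_sdiff.2 ⟨by simpa using hw.2.symm, fun h ↦ (hPR w h w hw.1).1 rfl⟩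
    omega

/-- In a cubic graph of small second eigenvalue on at least eight vertices there are no
triangles. -/
theorem not_adj_of_lt_sqrt_two (hreg : G.IsRegularOfDegree 3) (hlt : secondEigenvalue G < √2)
    (hn : 8 ≤ Fintype.card V) {x y z : V} (hxy : G.Adj x y) (hyz : G.Adj y z) :
    ¬ G.Adj z x := fun hzx ↦ by
  have hc : #{x, y, z} = 3 := card_eq_three.2 ⟨x, y, z, hxy.ne, hzx.ne', hyz.ne, rfl⟩
  refine hlt.not_ge (sqrt_two_le_of_minDegree_two hreg (C := {x, y, z}) ?_ ?_ ?_ ?_)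
  · omega
  · omega
  · intro c hcm
    simp only [mem_insert, mem_singleton] at hcm
    rcases hcm with rfl | rfl | rfl
    · exact ⟨y, by simp, z, by simp, hyz.ne, hxy, hzx.symm⟩
    · exact ⟨x, by simp, z, by simp, hzx.ne', hxy.symm, hyz⟩
    · exact ⟨x, by simp, y, by simp, hxy.ne, hzx, hyz.symm⟩
  · omega

/-- In a cubic graph of small second eigenvalue on at least ten vertices there are no
four-cycles. -/
theorem eq_of_adj_of_lt_sqrt_two (hreg : G.IsRegularOfDegree 3) (hlt : secondEigenvalue G < √2)
    (hn : 10 ≤ Fintype.card V) {x y z w : V} (hxz : x ≠ z) (hxy : G.Adj x y) (hyz : G.Adj y z)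
    (hxw : G.Adj x w) (hwz : G.Adj w z) : y = w := by
  by_contra hyw
  have hc : #{x, y, z, w} = 4 := by
    simp [card_insert_of_notMem, hxy.ne, hxz, hxw.ne, hyz.ne, hyw, hwz.ne']
  refine hlt.not_ge (sqrt_two_le_of_minDegree_two hreg (C := {x, y, z, w}) ?_ ?_ ?_ ?_)
  · omega
  · omega
  · intro c hcm
    simp only [mem_insert, mem_singleton] at hcm
    rcases hcm with rfl | rfl | rfl | rfl
    · exact ⟨y, by simp, w, by simp, hyw, hxy, hxw⟩
    · exact ⟨x, by simp, z, by simp, hxz, hxy.symm, hyz⟩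
    · exact ⟨y, by simp, w, by simp, hyw, hyz.symm, hwz.symm⟩
    · exact ⟨x, by simp, z, by simp, hxz, hxw.symm, hwz⟩
  · omega

/-- The vertices reached from `u` by walks of length two: in a cubic graph without four-cycles
there are seven of them. -/
theorem card_biUnion_neighborFinset (hreg : G.IsRegularOfDegree 3)
    (hlt : secondEigenvalue G < √2) (hn : 10 ≤ Fintype.card V) (u : V) :
    #((G.neighborFinset u).biUnion fun w ↦ G.neighborFinset w) = 7 := by
  have h1 : (G.neighborFinset u).biUnion (fun w ↦ G.neighborFinset w) =
      insert u ((G.neighborFinset u).biUnion fun w ↦ (G.neighborFinset w).erase u) := by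
    obtain ⟨w, hw⟩ : (G.neighborFinset u).Nonempty := by
      rw [← card_pos, G.card_neighborFinset_eq_degree, hreg.degree_eq]
      norm_num
    ext x
    simp only [mem_biUnion, mem_insert, mem_erase, G.mem_neighborFinset] at hw ⊢
    by_cases hx : x = u
    · subst hx
      simpa using ⟨w, hw, hw.symm⟩
    · simp [hx]
  rw [h1, card_insert_of_notMem (by simp), card_biUnion]
  · have : ∀ w ∈ G.neighborFinset u, #((G.neighborFinset w).erase u) = 2 := fun w hw ↦ by
      rw [card_erase_of_mem (by simpa [G.adj_comm] using hw), G.card_neighborFinset_eq_degree,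
        hreg.degree_eq]
    rw [sum_congr rfl this, sum_const, G.card_neighborFinset_eq_degree, hreg.degree_eq]
    rfl
  · intro w hw w' hw' hne
    refine disjoint_left.2 fun x hx hx' ↦ hne ?_
    simp only [mem_erase, G.mem_neighborFinset, mem_coe] at hw hw' hx hx'
    exact eq_of_adj_of_lt_sqrt_two hreg hlt hn (Ne.symm hx.1) hw hx.2 hw' hx'.2

/-- A cubic graph on twelve vertices contains a triangle, a four-cycle or a five-cycle. -/
theorem sqrt_two_le_of_card_eq_twelve (hreg : G.IsRegularOfDegree 3)
    (hn : Fintype.card V = 12) : √2 ≤ secondEigenvalue G := by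
  by_contra! hlt
  obtain ⟨u⟩ : Nonempty V := Fintype.card_pos_iff.1 (by omega)
  obtain ⟨v, hv⟩ : (G.neighborFinset u).Nonempty := by
    rw [← card_pos, G.card_neighborFinset_eq_degree, hreg.degree_eq]
    norm_num
  rw [G.mem_neighborFinset] at hv
  have htri : ∀ {x y z : V}, G.Adj x y → G.Adj y z → ¬ G.Adj z x :=
    fun h h' ↦ not_adj_of_lt_sqrt_two hreg hlt (by omega) h h'
  have hdis : Disjoint ((G.neighborFinset u).biUnion fun w ↦ G.neighborFinset w)
      ((G.neighborFinset v).biUnion fun w ↦ G.neighborFinset w) := by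
    refine disjoint_left.2 fun x hx hx' ↦ ?_
    simp only [mem_biUnion, G.mem_neighborFinset] at hx hx'
    obtain ⟨a, hua, hax⟩ := hx
    obtain ⟨b, hvb, hbx⟩ := hx'
    have hav : a ≠ v := by
      rintro rfl
      exact htri hax hbx.symm hvb.symm
    have hbu : b ≠ u := by
      rintro rfl
      exact htri hax hbx.symm hua
    have hab : a ≠ b := by
      rintro rfl
      exact htri hua hvb.symm hv.symm
    have hxu : x ≠ u := by
      rintro rfl
      exact htri hv hvb hbx
    have hxv : x ≠ v := by
      rintro rfl
      exact htri hv hax.symm hua.symm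
    refine hlt.not_ge (sqrt_two_le_of_minDegree_two hreg (C := {u, v, a, b, x}) ?_ ?_ ?_ ?_)
    · refine (card_le_card (s := {u, v, a}) ?_).trans' ?_
      · intro y hy
        simp only [mem_insert, mem_singleton] at hy ⊢
        tauto
      · rw [card_eq_three.2 ⟨u, v, a, hv.ne, hua.ne, hav.symm, rfl⟩]
    · exact card_le_five
    · intro c hcm
      simp only [mem_insert, mem_singleton] at hcm
      rcases hcm with rfl | rfl | rfl | rfl | rfl
      · exact ⟨v, by simp, a, by simp, hav.symm, hv, hua⟩
      · exact ⟨u, by simp, b, by simp, hbu.symm, hv.symm, hvb⟩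
      · exact ⟨u, by simp, x, by simp, hxu.symm, hua.symm, hax⟩
      · exact ⟨v, by simp, x, by simp, hxv.symm, hvb.symm, hbx⟩
      · exact ⟨a, by simp, b, by simp, hab, hax.symm, hbx.symm⟩
    · have : #{u, v, a, b, x} ≤ 5 := card_le_five
      omega
  have h := card_union_of_disjoint hdis
  rw [card_biUnion_neighborFinset hreg hlt (by omega),
    card_biUnion_neighborFinset hreg hlt (by omega)] at h
  have := card_le_univ ((G.neighborFinset u).biUnion (fun w ↦ G.neighborFinset w) ∪
    (G.neighborFinset v).biUnion fun w ↦ G.neighborFinset w)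
  omega

/-- An eigenvalue of a cubic graph on at most six vertices, other than the degree, is at most
one. -/
theorem eigenvalue_le_one_of_card_le_six (hreg : G.IsRegularOfDegree 3)
    (hn : Fintype.card V ≤ 6) {f : V → ℝ} {μ : ℝ} (hf0 : f ≠ 0) (hsum : ∑ u, f u = 0)
    (hf : ∀ u, ∑ w ∈ G.neighborFinset u, f w = μ * f u) : μ ≤ 1 := by
  obtain ⟨v, hv⟩ := Function.ne_iff.1 hf0
  obtain ⟨x, -, hx⟩ := exists_max_image univ (fun u ↦ |f u|) ⟨v, mem_univ v⟩
  have hx0 : 0 < |f x| := (abs_pos.2 hv).trans_le (hx v (mem_univ v))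
  have hxN : x ∉ G.neighborFinset x := by simp
  have hcard : #(insert x (G.neighborFinset x))ᶜ ≤ 2 := by
    rw [card_compl, card_insert_of_notMem hxN, G.card_neighborFinset_eq_degree, hreg.degree_eq]
    omega
  have h1 : ∑ u ∈ (insert x (G.neighborFinset x))ᶜ, f u = -((1 + μ) * f x) := by
    have := sum_add_sum_compl (insert x (G.neighborFinset x)) f
    rw [sum_insert hxN, hf, hsum] at this
    linarith
  have h2 : |∑ u ∈ (insert x (G.neighborFinset x))ᶜ, f u| ≤ 2 * |f x| := by
    refine (abs_sum_le_sum_abs _ _).trans ((sum_le_card_nsmul _ _ _ fun u _ ↦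
      hx u (mem_univ u)).trans ?_)
    rw [nsmul_eq_mul]
    exact mul_le_mul_of_nonneg_right (by exact_mod_cast hcard) hx0.le
  rw [h1, abs_neg, abs_mul] at h2
  have h3 := le_of_mul_le_mul_right h2 hx0
  linarith [le_abs_self (1 + μ)]

/-- A cubic graph on ten vertices without triangles and four-cycles is strongly regular, and its
eigenvalues other than the degree are at most one. -/
theorem eigenvalue_le_one_of_card_eq_ten (hreg : G.IsRegularOfDegree 3)
    (hlt : secondEigenvalue G < √2) (hn : Fintype.card V = 10) {f : V → ℝ} {μ : ℝ}
    (hf0 : f ≠ 0) (hsum : ∑ u, f u = 0)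
    (hf : ∀ u, ∑ w ∈ G.neighborFinset u, f w = μ * f u) : μ ≤ 1 := by
  obtain ⟨v, hv⟩ := Function.ne_iff.1 hf0
  have hvv : v ∉ G.neighborFinset v := by simp
  have h1 : (G.neighborFinset v).biUnion (fun w ↦ G.neighborFinset w) =
      (G.neighborFinset v)ᶜ := by
    refine eq_of_subset_of_card_le (fun x hx ↦ ?_) ?_
    · simp only [mem_biUnion, mem_compl, G.mem_neighborFinset] at hx ⊢
      obtain ⟨w, hvw, hwx⟩ := hx
      exact fun h ↦ not_adj_of_lt_sqrt_two hreg hlt (by omega) hvw hwx h.symm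
    · rw [card_biUnion_neighborFinset hreg hlt (by omega), card_compl,
        G.card_neighborFinset_eq_degree, hreg.degree_eq, hn]
  have h2 : ∑ w ∈ G.neighborFinset v, ∑ x ∈ (G.neighborFinset w).erase v, f x =
      ∑ x ∈ ((G.neighborFinset v)ᶜ).erase v, f x := by
    rw [← h1, erase_biUnion, sum_biUnion]
    intro w hw w' hw' hne
    refine disjoint_left.2 fun x hx hx' ↦ hne ?_
    simp only [mem_erase, G.mem_neighborFinset, mem_coe] at hw hw' hx hx'
    exact eq_of_adj_of_lt_sqrt_two hreg hlt (by omega) (Ne.symm hx.1) hw hx.2 hw' hx'.2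
  have h3 : ∑ w ∈ G.neighborFinset v, ∑ x ∈ (G.neighborFinset w).erase v, f x =
      μ * (μ * f v) - 3 * f v := by
    have : ∀ w ∈ G.neighborFinset v, ∑ x ∈ (G.neighborFinset w).erase v, f x = μ * f w - f v :=
      fun w hw ↦ by
        rw [sum_erase_eq_sub (by simpa [G.adj_comm] using hw), hf]
    rw [sum_congr rfl this, sum_sub_distrib, ← mul_sum, hf, sum_const,
      G.card_neighborFinset_eq_degree, hreg.degree_eq]
    simp
  have h4 : ∑ x ∈ ((G.neighborFinset v)ᶜ).erase v, f x = -(μ * f v) - f v := by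
    have := sum_add_sum_compl (G.neighborFinset v) f
    rw [sum_erase_eq_sub (by simp)]
    rw [hf, hsum] at this
    linarith
  have h5 : (μ - 1) * (μ + 2) * f v = 0 := by
    rw [h2, h4] at h3
    linear_combination -h3
  by_contra! h
  have := (mul_eq_zero.1 h5).resolve_right hv
  nlinarith

/-- A cubic triangle-free graph on eight vertices has no eigenvalue greater than one other than
the degree. -/
theorem eigenvalue_le_one_of_card_eq_eight (hreg : G.IsRegularOfDegree 3)
    (htri : ∀ x y z : V, G.Adj x y → G.Adj y z → ¬ G.Adj z x) (hn : Fintype.card V = 8)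
    {f : V → ℝ} {μ : ℝ} (hf0 : f ≠ 0) (hsum : ∑ u, f u = 0)
    (hf : ∀ u, ∑ w ∈ G.neighborFinset u, f w = μ * f u) : μ ≤ 1 := by
  by_contra! hμ
  have hN : ∀ u, #(G.neighborFinset u) = 3 := fun u ↦ by
    rw [G.card_neighborFinset_eq_degree, hreg.degree_eq]
  have hdis : ∀ x y, G.Adj x y → Disjoint (G.neighborFinset x) (G.neighborFinset y) :=
    fun x y hxy ↦ disjoint_left.2 fun w hxw hyw ↦ by
      rw [G.mem_neighborFinset] at hxw hyw
      exact htri x y w hxy hyw hxw.symm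
  have hcard : ∀ x y, G.Adj x y → #(G.neighborFinset x ∪ G.neighborFinset y)ᶜ = 2 :=
    fun x y hxy ↦ by
      rw [card_compl, card_union_of_disjoint (hdis x y hxy), hN, hN, hn]
  have hedge : ∀ x y, G.Adj x y →
      ∑ w ∈ (G.neighborFinset x ∪ G.neighborFinset y)ᶜ, f w = -(μ * (f x + f y)) :=
    fun x y hxy ↦ by
      have := sum_add_sum_compl (G.neighborFinset x ∪ G.neighborFinset y) f
      rw [sum_union (hdis x y hxy), hf, hf, hsum] at this
      linarith
  obtain ⟨x, y, hxy, hs⟩ : ∃ x y, G.Adj x y ∧ f x + f y ≠ 0 := by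
    by_contra! h
    obtain ⟨v, hv⟩ := Function.ne_iff.1 hf0
    have h1 : ∑ w ∈ G.neighborFinset v, f w = ∑ w ∈ G.neighborFinset v, -f v :=
      sum_congr rfl fun w hw ↦ by
        have := h v w (by simpa using hw)
        linarith
    rw [hf, sum_const, hN] at h1
    have h2 : (μ + 3) * f v = 0 := by
      rw [nsmul_eq_mul] at h1
      push_cast at h1
      linarith
    have := (mul_eq_zero.1 h2).resolve_right hv
    linarith
  obtain ⟨p, q, hpq, hD⟩ := card_eq_two.1 (hcard x y hxy)
  have hDmem : ∀ z, (¬ G.Adj x z ∧ ¬ G.Adj y z) ↔ z = p ∨ z = q := fun z ↦ by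
    have : z ∈ (G.neighborFinset x ∪ G.neighborFinset y)ᶜ ↔ z ∈ ({p, q} : Finset V) := by rw [hD]
    simpa using this
  obtain ⟨hxp, hyp⟩ := (hDmem p).2 (.inl rfl)
  obtain ⟨hxq, hyq⟩ := (hDmem q).2 (.inr rfl)
  have hpx : p ≠ x := fun h ↦ hyp (h ▸ hxy.symm)
  have hpy : p ≠ y := fun h ↦ hxp (h ▸ hxy)
  have hqx : q ≠ x := fun h ↦ hyq (h ▸ hxy.symm)
  have hqy : q ≠ y := fun h ↦ hxq (h ▸ hxy)
  have hpqs : f p + f q = -(μ * (f x + f y)) := by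
    rw [← hedge x y hxy, hD, sum_pair hpq]
  have hnpq : ¬ G.Adj p q := fun hadj ↦ by
    have h1 : {x, y} = (G.neighborFinset p ∪ G.neighborFinset q)ᶜ := by
      refine eq_of_subset_of_card_le (fun w hw ↦ ?_) ?_
      · rw [mem_insert, mem_singleton] at hw
        simp only [mem_compl, mem_union, G.mem_neighborFinset, G.adj_comm _ w]
        rcases hw with rfl | rfl <;> tauto
      · rw [hcard p q hadj, card_pair hxy.ne]
    have h2 := hedge p q hadj
    rw [← h1, sum_pair hxy.ne, hpqs] at h2
    have h3 : (μ - 1) * (μ + 1) * (f x + f y) = 0 := by linear_combination -h2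
    have := (mul_eq_zero.1 h3).resolve_right hs
    nlinarith
  set M : Finset V := ({x, y, p, q} : Finset V)ᶜ with hM
  have hMmem : ∀ z, z ∈ M ↔ z ≠ x ∧ z ≠ y ∧ z ≠ p ∧ z ≠ q := fun z ↦ by simp [hM]
  have h4 : #{x, y, p, q} = 4 := by
    simp [card_insert_of_notMem, hxy.ne, hpx.symm, hqx.symm, hpy.symm, hqy.symm, hpq]
  have hMcard : #M = 4 := by
    rw [hM, card_compl, h4, hn]
  have hMadj : ∀ z ∈ M, G.Adj x z ∨ G.Adj y z := fun z hz ↦ by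
    have := hDmem z
    have := (hMmem z).1 hz
    tauto
  have hMsum : ∑ z ∈ M, f z = (μ - 1) * (f x + f y) := by
    have := sum_add_sum_compl ({x, y, p, q} : Finset V) f
    rw [sum_insert (by simp [hxy.ne, hpx.symm, hqx.symm]),
      sum_insert (by simp [hpy.symm, hqy.symm]), sum_pair hpq, hpqs, hsum] at this
    rw [hM]
    linarith
  have hmiss : ∀ r, ¬ G.Adj x r → ¬ G.Adj y r → ¬ G.Adj r p → ¬ G.Adj r q →
      ∃ m ∈ M, G.neighborFinset r = M.erase m := fun r hxr hyr hrp hrq ↦ by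
    have hsub : G.neighborFinset r ⊆ M := fun w hw ↦ by
      rw [G.mem_neighborFinset] at hw
      refine (hMmem w).2 ⟨?_, ?_, ?_, ?_⟩ <;> rintro rfl
      exacts [hxr hw.symm, hyr hw.symm, hrp hw, hrq hw]
    have h1 : #(M \ G.neighborFinset r) = 1 := by
      rw [card_sdiff_of_subset hsub, hN, hMcard]
    obtain ⟨m, hm⟩ := card_eq_one.1 h1
    refine ⟨m, (mem_sdiff.1 (hm ▸ mem_singleton_self m)).1, ?_⟩
    rw [← sdiff_singleton_eq_erase, ← hm, Finset.sdiff_sdiff_eq_self hsub]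
  obtain ⟨m, hmM, hm⟩ := hmiss p hxp hyp (G.irrefl) hnpq
  obtain ⟨m', hmM', hm'⟩ := hmiss q hxq hyq (fun h ↦ hnpq h.symm) (G.irrefl)
  have hsat : ∀ z ∈ M, z ≠ m → z ≠ m' → ∀ w ∈ M, ¬ G.Adj z w := fun z hz hzm hzm' w hw hzw ↦ by
    have hpz : G.Adj p z := by rw [← G.mem_neighborFinset, hm]; exact mem_erase.2 ⟨hzm, hz⟩
    have hqz : G.Adj q z := by rw [← G.mem_neighborFinset, hm']; exact mem_erase.2 ⟨hzm', hz⟩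
    obtain ⟨hwx, hwy, hwp, hwq⟩ := (hMmem w).1 hw
    obtain ⟨t, htz, htp, htq, htw⟩ : ∃ t, G.Adj t z ∧ t ≠ p ∧ t ≠ q ∧ t ≠ w := by
      rcases hMadj z hz with h | h
      · exact ⟨x, h, hpx.symm, hqx.symm, hwx.symm⟩
      · exact ⟨y, h, hpy.symm, hqy.symm, hwy.symm⟩
    have h5 : #{t, p, q, w} = 4 := by
      simp [card_insert_of_notMem, htp, htq, htw, hpq, hwp.symm, hwq.symm]
    have h6 : {t, p, q, w} ⊆ G.neighborFinset z := fun v hv ↦ by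
      simp only [mem_insert, mem_singleton] at hv
      rw [G.mem_neighborFinset]
      rcases hv with rfl | rfl | rfl | rfl
      exacts [htz.symm, hpz.symm, hqz.symm, hzw]
    have := card_le_card h6
    rw [hN] at this
    omega
  have hmp : ¬ G.Adj m p := fun h ↦ by
    have : m ∈ G.neighborFinset p := by simpa using h.symm
    simp [hm] at this
  have hmm' : G.Adj m m' := by
    obtain ⟨t, ht⟩ : ∃ t, G.neighborFinset m ⊆ {t, q, m'} := by
      have key : ∀ w, G.Adj m w → w = x ∨ w = y ∨ w = q ∨ w = m' := fun w hw ↦ by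
        by_contra! h
        have hwM : w ∈ M := (hMmem w).2 ⟨h.1, h.2.1, fun hwp ↦ hmp (hwp ▸ hw), h.2.2.1⟩
        exact hsat w hwM hw.ne' h.2.2.2 m hmM hw.symm
      rcases hMadj m hmM with h | h
      · refine ⟨x, fun w hw ↦ ?_⟩
        rw [G.mem_neighborFinset] at hw
        have hwy : w ≠ y := by
          rintro rfl
          exact htri x m w h hw hxy.symm
        have := key w hw
        simp only [mem_insert, mem_singleton]
        tauto
      · refine ⟨y, fun w hw ↦ ?_⟩
        rw [G.mem_neighborFinset] at hw
        have hwx : w ≠ x := by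
          rintro rfl
          exact htri y m w h hw hxy
        have := key w hw
        simp only [mem_insert, mem_singleton]
        tauto
    have h7 := eq_of_subset_of_card_le ht (by rw [hN]; exact card_le_three)
    rw [← G.mem_neighborFinset, h7]
    simp
  have hE : (M.erase m).erase m' = (G.neighborFinset m ∪ G.neighborFinset m')ᶜ := by
    refine eq_of_subset_of_card_le (fun z hz ↦ ?_) ?_
    · simp only [mem_erase] at hz
      simp only [mem_compl, mem_union, G.mem_neighborFinset, not_or, G.adj_comm _ z]
      exact ⟨hsat z hz.2.2 hz.2.1 hz.1 m hmM, hsat z hz.2.2 hz.2.1 hz.1 m' hmM'⟩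
    · rw [hcard m m' hmm', card_erase_of_mem (mem_erase.2 ⟨hmm'.ne', hmM'⟩),
        card_erase_of_mem hmM, hMcard]
  have e1 := hedge m m' hmm'
  rw [← hE, sum_erase_eq_sub (mem_erase.2 ⟨hmm'.ne', hmM'⟩), sum_erase_eq_sub hmM, hMsum] at e1
  have e2 := hf p
  rw [hm, sum_erase_eq_sub hmM, hMsum] at e2
  have e3 := hf q
  rw [hm', sum_erase_eq_sub hmM', hMsum] at e3
  have e4 : (μ - 1) * (f x + f y + f m + f m') = 0 := by linear_combination e1
  have e5 : f x + f y + f m + f m' = 0 :=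
    (mul_eq_zero.1 e4).resolve_left (sub_ne_zero.2 hμ.ne')
  have e6 : (μ ^ 2 + 2 * μ - 1) * (f x + f y) = 0 := by
    linear_combination e2 + e3 + e5 + μ * hpqs
  have := (mul_eq_zero.1 e6).resolve_right hs
  nlinarith

end Cubic

theorem stmt17 {V : Type*} [Fintype V] [DecidableEq V] (G : SimpleGraph V) [DecidableRel G.Adj]
    (hconn : G.Connected) (hreg : G.IsRegularOfDegree 3)
    (hlam : 1 < secondEigenvalue G) :
    Real.sqrt 2 ≤ secondEigenvalue G := by
  by_contra! hlt
  obtain ⟨v⟩ := hconn.nonempty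
  have h4 : 4 ≤ Fintype.card V := by
    have := G.degree_lt_card_verts v
    rw [hreg.degree_eq] at this
    omega
  have heven : Even (Fintype.card V) := by
    have h := G.sum_degrees_eq_twice_card_edges
    simp only [hreg.degree_eq, Finset.sum_const, Finset.card_univ, smul_eq_mul] at h
    rw [Nat.even_iff]
    omega
  obtain ⟨f, hf0, hsum, hf⟩ := exists_eigenfunction_secondEigenvalue hreg (by omega)
    (by push_cast; linarith [sqrt_two_le_seventeen_div_twelve])
  have hcases : Fintype.card V ≤ 6 ∨ Fintype.card V = 8 ∨ Fintype.card V = 10 ∨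
      Fintype.card V = 12 ∨ 14 ≤ Fintype.card V := by
    rw [Nat.even_iff] at heven
    omega
  rcases hcases with h | h | h | h | h
  · exact hlam.not_ge (eigenvalue_le_one_of_card_le_six hreg h hf0 hsum hf)
  · exact hlam.not_ge (eigenvalue_le_one_of_card_eq_eight hreg
      (fun _ _ _ h₁ h₂ ↦ not_adj_of_lt_sqrt_two hreg hlt h.ge h₁ h₂) h hf0 hsum hf)
  · exact hlam.not_ge (eigenvalue_le_one_of_card_eq_ten hreg hlt h hf0 hsum hf)
  · exact hlt.not_ge (sqrt_two_le_of_card_eq_twelve hreg h)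
  · exact hlt.not_ge (sqrt_two_le_of_fourteen_le_card hreg h)
end

section
/- If G is a connected 4-regular finite simple graph whose second largest adjacency eigenvalue satisfies λ₂(G) > 1, then λ₂(G) ≥ √5 − 1. -/
open Polynomial

namespace RegularSearch

/-- The real number represented by an element of `ℤ[√5]`. -/
noncomputable def val (a : Zsqrtd 5) : ℝ := a.re + a.im * Real.sqrt 5

/-- The element `a * b - c * d` of `ℤ[√5]`. -/
def mulSub (a b c d : Zsqrtd 5) : Zsqrtd 5 :=
  ⟨a.re * b.re + 5 * (a.im * b.im) - (c.re * d.re + 5 * (c.im * d.im)),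
   a.re * b.im + a.im * b.re - (c.re * d.im + c.im * d.re)⟩

/-- Decides whether an element of `ℤ[√5]` is a positive real. -/
def isPos (a : Zsqrtd 5) : Bool :=
  if 0 ≤ a.im then (0 < a.re || a.re * a.re < 5 * (a.im * a.im))
  else (0 < a.re && 5 * (a.im * a.im) < a.re * a.re)

/-- Decides whether an element of `ℤ[√5]` is zero. -/
def isZero (a : Zsqrtd 5) : Bool := a.re == 0 && a.im == 0

/-- The row operation `a • r - c • e`. -/
def rowUpdate (a c : Zsqrtd 5) : List (Zsqrtd 5) → List (Zsqrtd 5) → List (Zsqrtd 5)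
  | m :: ms, e :: es => mulSub a m c e :: rowUpdate a c ms es
  | _, _ => []

/-- The fraction-free Schur complement `a • M - bᵀ b` of a symmetric matrix given by its
upper-triangular rows. -/
def schur (a : Zsqrtd 5) : List (Zsqrtd 5) → List (List (Zsqrtd 5)) → List (List (Zsqrtd 5))
  | c :: cs, r :: M => rowUpdate a c r (c :: cs) :: schur a cs M
  | _, _ => []

/-- Symmetric elimination test that succeeds on positive definite matrices. -/
def posDefTest : ℕ → List (List (Zsqrtd 5)) → Bool
  | n + 1, (a :: b) :: M => isPos a && posDefTest n (schur a b M)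
  | _, _ => true

/-- Symmetric elimination test that succeeds only on positive semidefinite matrices. -/
def psdTest : ℕ → List (List (Zsqrtd 5)) → Bool
  | n + 1, (a :: b) :: M =>
    if isPos a then psdTest n (schur a b M) else isZero a && b.all isZero && psdTest n M
  | _, [] => true
  | _, _ => false

/-- The linear form with the given coefficients. -/
noncomputable def linForm : List (Zsqrtd 5) → List ℝ → ℝ
  | c :: cs, x :: xs => val c * x + linForm cs xs
  | _, _ => 0

/-- The quadratic form of a symmetric matrix given by its upper-triangular rows. -/
noncomputable def quadForm : List (List (Zsqrtd 5)) → List ℝ → ℝ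
  | (a :: b) :: M, x :: xs => val a * x ^ 2 + 2 * x * linForm b xs + quadForm M xs
  | _, _ => 0

/-- The rows have the lengths of an upper-triangular array. -/
def IsTriangular : List (List (Zsqrtd 5)) → Prop
  | [] => True
  | r :: M => r.length = M.length + 1 ∧ IsTriangular M

theorem val_mulSub (a b c d : Zsqrtd 5) :
    val (mulSub a b c d) = val a * val b - val c * val d := by
  have h : Real.sqrt 5 ^ 2 = 5 := Real.sq_sqrt (by norm_num)
  simp only [val, mulSub]
  push_cast
  linear_combination ((c.im : ℝ) * d.im - a.im * b.im) * h

theorem isPos_iff (a : Zsqrtd 5) : isPos a = true ↔ 0 < val a := by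
  have h : Real.sqrt 5 ^ 2 = 5 := Real.sq_sqrt (by norm_num)
  have h0 : 0 < Real.sqrt 5 := by positivity
  have key : (a.re * a.re < 5 * (a.im * a.im)) ↔ (a.re : ℝ) ^ 2 < (a.im * Real.sqrt 5) ^ 2 := by
    rw [mul_pow, h, ← Int.cast_lt (R := ℝ)]
    push_cast
    constructor <;> intro h <;> nlinarith
  have key' : (5 * (a.im * a.im) < a.re * a.re) ↔ (a.im * Real.sqrt 5) ^ 2 < (a.re : ℝ) ^ 2 := by
    rw [mul_pow, h, ← Int.cast_lt (R := ℝ)]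
    push_cast
    constructor <;> intro h <;> nlinarith
  unfold isPos val
  split_ifs with hi
  · have hi' : 0 ≤ (a.im : ℝ) * Real.sqrt 5 := mul_nonneg (by exact_mod_cast hi) h0.le
    rw [Bool.or_eq_true, decide_eq_true_eq, decide_eq_true_eq, key, ← Int.cast_pos (R := ℝ)]
    constructor
    · rintro (h1 | h1)
      · linarith
      · have := abs_lt_of_sq_lt_sq h1 hi'
        linarith [(abs_lt.1 this).1]
    · intro h1
      by_cases h2 : 0 < (a.re : ℝ)
      · exact Or.inl h2
      · exact Or.inr (by nlinarith)
  · have hi' : (a.im : ℝ) * Real.sqrt 5 < 0 :=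
      mul_neg_of_neg_of_pos (by exact_mod_cast not_le.1 hi) h0
    rw [Bool.and_eq_true, decide_eq_true_eq, decide_eq_true_eq, key', ← Int.cast_pos (R := ℝ)]
    constructor
    · rintro ⟨h1, h2⟩
      nlinarith
    · intro h1
      exact ⟨by linarith, by nlinarith⟩

theorem val_eq_zero_of_isZero {a : Zsqrtd 5} (h : isZero a = true) : val a = 0 := by
  simp only [isZero, Bool.and_eq_true, beq_iff_eq] at h
  simp [val, h.1, h.2]

theorem linForm_rowUpdate (a c : Zsqrtd 5) :
    ∀ (r e : List (Zsqrtd 5)) (xs : List ℝ), r.length = e.length →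
      linForm (rowUpdate a c r e) xs = val a * linForm r xs - val c * linForm e xs
  | [], [], _, _ => by simp [rowUpdate, linForm]
  | m :: ms, e :: es, [], _ => by simp [rowUpdate, linForm]
  | m :: ms, e :: es, x :: xs, h => by
    simp only [List.length_cons, Nat.add_right_cancel_iff] at h
    simp only [rowUpdate, linForm, val_mulSub, linForm_rowUpdate a c ms es xs h]
    ring

theorem length_rowUpdate (a c : Zsqrtd 5) :
    ∀ r e : List (Zsqrtd 5), r.length = e.length → (rowUpdate a c r e).length = r.length
  | [], [], _ => rfl
  | m :: ms, e :: es, h => by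
    simp only [List.length_cons, Nat.add_right_cancel_iff] at h
    simp [rowUpdate, length_rowUpdate a c ms es h]

theorem length_schur (a : Zsqrtd 5) :
    ∀ (b : List (Zsqrtd 5)) (M : List (List (Zsqrtd 5))), b.length = M.length →
      (schur a b M).length = M.length
  | [], [], _ => rfl
  | c :: cs, r :: M, h => by
    simp only [List.length_cons, Nat.add_right_cancel_iff] at h
    simp [schur, length_schur a cs M h]

theorem isTriangular_schur (a : Zsqrtd 5) :
    ∀ (b : List (Zsqrtd 5)) (M : List (List (Zsqrtd 5))), b.length = M.length →
      IsTriangular M → IsTriangular (schur a b M)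
  | [], [], _, _ => trivial
  | c :: cs, r :: M, h, hM => by
    simp only [List.length_cons, Nat.add_right_cancel_iff] at h
    refine ⟨?_, isTriangular_schur a cs M h hM.2⟩
    rw [length_rowUpdate, length_schur a cs M h, hM.1]
    simp [hM.1, h]

theorem quadForm_schur (a : Zsqrtd 5) :
    ∀ (b : List (Zsqrtd 5)) (M : List (List (Zsqrtd 5))) (xs : List ℝ), b.length = M.length →
      IsTriangular M →
      quadForm (schur a b M) xs = val a * quadForm M xs - linForm b xs ^ 2
  | [], [], _, _, _ => by simp [schur, quadForm, linForm]
  | c :: cs, [] :: M, xs, h, hM => by simp [IsTriangular] at hM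
  | c :: cs, (p :: q) :: M, [], h, hM => by simp [schur, rowUpdate, quadForm, linForm]
  | c :: cs, (p :: q) :: M, x :: xs, h, hM => by
    simp only [List.length_cons, Nat.add_right_cancel_iff] at h
    have hq : q.length = cs.length := by
      have := hM.1
      simp only [List.length_cons, Nat.add_right_cancel_iff] at this
      rw [this, h]
    simp only [schur, rowUpdate, quadForm, linForm, val_mulSub, linForm_rowUpdate a c q cs xs hq,
      quadForm_schur a cs M xs h hM.2]
    ring

theorem quadForm_nonneg_of_psdTest :
    ∀ (n : ℕ) (M : List (List (Zsqrtd 5))), IsTriangular M → psdTest n M = true →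
      ∀ xs, 0 ≤ quadForm M xs
  | _, [], _, _, xs => by simp [quadForm]
  | 0, _ :: _, _, h, _ => by simp [psdTest] at h
  | n + 1, [] :: M, hM, _, _ => by simp [IsTriangular] at hM
  | n + 1, (a :: b) :: M, _, _, [] => by simp [quadForm]
  | n + 1, (a :: b) :: M, hM, h, x :: xs => by
    have hb : b.length = M.length := by simpa using hM.1
    simp only [psdTest] at h
    split_ifs at h with ha
    · rw [isPos_iff] at ha
      have h1 := quadForm_nonneg_of_psdTest n _ (isTriangular_schur a b M hb hM.2) h xs
      rw [quadForm_schur a b M xs hb hM.2] at h1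
      have h2 : 0 ≤ val a * quadForm ((a :: b) :: M) (x :: xs) := by
        simp only [quadForm]
        nlinarith [sq_nonneg (val a * x + linForm b xs)]
      exact nonneg_of_mul_nonneg_right h2 ha
    · simp only [Bool.and_eq_true, List.all_eq_true] at h
      have hz : ∀ (b : List (Zsqrtd 5)) (xs : List ℝ), (∀ c ∈ b, isZero c = true) →
          linForm b xs = 0 := by
        intro b
        induction b with
        | nil => simp [linForm]
        | cons c cs ih =>
          rintro (_ | ⟨x, xs⟩) hc
          · simp [linForm]
          · simp [linForm, val_eq_zero_of_isZero (hc c (by simp)),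
              ih xs fun d hd => hc d (by simp [hd])]
      simp only [quadForm, val_eq_zero_of_isZero h.1.1, hz b xs h.1.2]
      simpa using quadForm_nonneg_of_psdTest n M hM.2 h.2 xs

theorem linForm_replicate_zero : ∀ (b : List (Zsqrtd 5)) (k : ℕ),
    linForm b (List.replicate k 0) = 0
  | [], _ => by simp [linForm]
  | _ :: _, 0 => by simp [linForm]
  | _ :: cs, k + 1 => by simp [linForm, List.replicate_succ, linForm_replicate_zero cs k]

theorem quadForm_replicate_zero : ∀ (M : List (List (Zsqrtd 5))) (k : ℕ),
    quadForm M (List.replicate k 0) = 0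
  | [], _ => by simp [quadForm]
  | [] :: _, _ => by simp [quadForm]
  | (_ :: _) :: _, 0 => by simp [quadForm]
  | (_ :: _) :: M, k + 1 => by
    simp [quadForm, List.replicate_succ, quadForm_replicate_zero M k]

theorem posDefTest_of_pos :
    ∀ (n : ℕ) (M : List (List (Zsqrtd 5))), IsTriangular M →
      (∀ xs : List ℝ, xs.length = M.length → (∃ x ∈ xs, x ≠ 0) → 0 < quadForm M xs) →
      posDefTest n M = true
  | 0, _, _, _ => by simp [posDefTest]
  | _ + 1, [], _, _ => by simp [posDefTest]
  | _ + 1, [] :: M, hM, _ => by simp [IsTriangular] at hM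
  | n + 1, (a :: b) :: M, hM, h => by
    have hb : b.length = M.length := by simpa using hM.1
    have ha : 0 < val a := by
      have := h (1 :: List.replicate M.length 0) (by simp) ⟨1, by simp, one_ne_zero⟩
      simpa [quadForm, linForm_replicate_zero, quadForm_replicate_zero] using this
    rw [posDefTest, (isPos_iff a).2 ha, Bool.true_and]
    refine posDefTest_of_pos n _ (isTriangular_schur a b M hb hM.2) fun xs hl hx => ?_
    rw [length_schur a b M hb] at hl
    obtain ⟨x, hx, hx0⟩ := hx
    have h1 := h ((-(linForm b xs) / val a) :: xs) (by simp [hl]) ⟨x, by simp [hx], hx0⟩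
    rw [quadForm_schur a b M xs hb hM.2]
    have h2 : val a * quadForm ((a :: b) :: M) ((-(linForm b xs) / val a) :: xs) =
        val a * quadForm M xs - linForm b xs ^ 2 := by
      simp only [quadForm]
      field_simp
      ring
    rw [← h2]
    exact mul_pos ha h1

/-- The upper-triangular rows of `weightMatrix` on the vertices of an adjacency table. -/
def gram (diag on off : Zsqrtd 5) (rows : List (List Bool)) : List (List (Zsqrtd 5)) :=
  rows.map fun r => diag :: r.map fun b => if b then on else off

/-- The rows of `n • (θ - A + (4 - θ) / n • J)` for `θ = √5 - 1`. -/
def thetaGram (n : ℕ) : List (List Bool) → List (List (Zsqrtd 5)) :=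
  gram ⟨5 - n, n - 1⟩ ⟨5 - n, -1⟩ ⟨5, -1⟩

/-- The rows of `n • (1 - A + 3 / n • J)`. -/
def oneGram (n : ℕ) : List (List Bool) → List (List (Zsqrtd 5)) :=
  gram ⟨n + 3, 0⟩ ⟨3 - n, 0⟩ ⟨3, 0⟩

/-- All adjacency rows of a new vertex which avoid the vertices whose degree is at least `4`. -/
def freeRows : List ℕ → List (List Bool)
  | [] => [[]]
  | d :: ds =>
    if d < 4 then (freeRows ds).flatMap fun r => [false :: r, true :: r]
    else (freeRows ds).map (false :: ·)

/-- The row contains the last vertex whose degree is different from `4`. -/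
def hits : List ℕ → List Bool → Bool
  | _ :: ds, b :: bs => if ds.all (· == 4) then b else hits ds bs
  | _, _ => false

/-- The degrees after a new vertex has been joined along a row. -/
def addDegs : List ℕ → List Bool → List ℕ
  | d :: ds, b :: bs => (d + b.toNat) :: addDegs ds bs
  | _, _ => []

/-- A numerical key used to order adjacency rows. -/
def rowKey : List Bool → ℕ
  | [] => 0
  | b :: bs => b.toNat + 2 * rowKey bs

/-- Exhaustive search showing that no `4`-regular graph extends the partial graph `rows` with
degree list `degs`. A new vertex is always joined to the oldest vertex of deficient degree, and is
chosen with the largest row; `prev` is the degree list before the newest vertex was added. If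
`full` is set, the graph has exactly `N` vertices, otherwise at least `N`; the first argument
after it is the number of vertices missing from `N`. -/
def search (N : ℕ) (full : Bool) : ℕ → List (List Bool) → List ℕ → List ℕ → Bool
  | 0, rows, _, _ => full && psdTest N (oneGram N rows)
  | m + 1, rows, degs, prev =>
    degs.all (· == 4) || (freeRows degs).all fun r =>
      !hits degs r || 4 < r.count true ||
        (hits prev r.tail && rowKey (rows.headD []) < rowKey r.tail) ||
        (let rows' := r :: rows
         let degs' := r.count true :: addDegs degs r
         (full && degs'.any (· + m < 4)) || (0 < m && !posDefTest N (thetaGram N rows')) ||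
          search N full m rows' degs' degs)

section Graph

variable {V : Type*} (G : SimpleGraph V)

theorem map_mem_freeRows (D : V → ℕ) (f : V → Bool) :
    ∀ vs : List V, (∀ u ∈ vs, f u = true → D u < 4) → vs.map f ∈ freeRows (vs.map D)
  | [], _ => by simp [freeRows]
  | v :: vs, h => by
    have ih := map_mem_freeRows D f vs fun u hu => h u (by simp [hu])
    have hv := h v (by simp)
    rw [List.map_cons, List.map_cons, freeRows]
    cases hf : f v
    · split_ifs
      · exact List.mem_flatMap.2 ⟨_, ih, by simp⟩
      · exact List.mem_map.2 ⟨_, ih, rfl⟩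
    · rw [if_pos (hv hf)]
      exact List.mem_flatMap.2 ⟨_, ih, by simp⟩

theorem exists_hits_iff (D : V → ℕ) :
    ∀ vs : List V, (∃ u ∈ vs, D u ≠ 4) →
      ∃ u ∈ vs, D u ≠ 4 ∧ ∀ f : V → Bool, hits (vs.map D) (vs.map f) = f u
  | [], h => by simp at h
  | v :: vs, h => by
    by_cases hv : ∃ u ∈ vs, D u ≠ 4
    · obtain ⟨u, hu, hu4, hf⟩ := exists_hits_iff D vs hv
      refine ⟨u, by simp [hu], hu4, fun f => ?_⟩
      rw [List.map_cons, List.map_cons, hits, if_neg, hf]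
      obtain ⟨w, hw, hw4⟩ := hv
      simp only [List.all_eq_true, List.mem_map, beq_iff_eq, not_forall]
      exact ⟨D w, ⟨w, hw, rfl⟩, hw4⟩
    · refine ⟨v, by simp, ?_, fun f => ?_⟩
      · obtain ⟨u, hu, hu4⟩ := h
        rcases List.mem_cons.1 hu with rfl | hu
        · exact hu4
        · exact absurd ⟨u, hu, hu4⟩ hv
      · rw [List.map_cons, List.map_cons, hits, if_pos]
        push Not at hv
        simpa using hv

theorem addDegs_map (D : V → ℕ) (f : V → Bool) :
    ∀ vs : List V, addDegs (vs.map D) (vs.map f) = vs.map fun u => D u + (f u).toNat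
  | [] => rfl
  | v :: vs => by simp [addDegs, addDegs_map D f vs]

theorem mem_of_closed (hconn : G.Connected) (vs : List V) (hne : vs ≠ [])
    (h : ∀ u ∈ vs, ∀ v, G.Adj u v → v ∈ vs) (w : V) : w ∈ vs := by
  obtain ⟨u, hu⟩ := List.exists_mem_of_ne_nil vs hne
  obtain ⟨p⟩ := hconn.preconnected u w
  induction p with
  | nil => exact hu
  | cons hadj _ ih => exact ih (h _ hu _ hadj)

variable [DecidableRel G.Adj]

/-- The adjacencies of `v` to a list of vertices. -/
def adjRow (vs : List V) (v : V) : List Bool := vs.map fun u => decide (G.Adj v u)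

/-- The lower-triangular adjacency table of a list of vertices. -/
def adjRows : List V → List (List Bool)
  | [] => []
  | v :: vs => adjRow G vs v :: adjRows vs

theorem length_adjRows : ∀ vs : List V, (adjRows G vs).length = vs.length
  | [] => rfl
  | _ :: vs => by simp [adjRows, length_adjRows vs]

/-- The number of neighbours of `v` in a list of vertices. -/
def degIn (vs : List V) (v : V) : ℕ := (adjRow G vs v).count true

theorem isTriangular_gram_adjRows (diag on off : Zsqrtd 5) :
    ∀ vs : List V, IsTriangular (gram diag on off (adjRows G vs))
  | [] => trivial
  | v :: vs => by
    refine ⟨?_, isTriangular_gram_adjRows diag on off vs⟩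
    simp [adjRow, length_adjRows]

theorem map_degIn_cons (vs : List V) (v : V) :
    (v :: vs).map (degIn G (v :: vs)) =
      (adjRow G vs v).count true :: addDegs (vs.map (degIn G vs)) (adjRow G vs v) := by
  rw [adjRow, addDegs_map, List.map_cons]
  congr 1
  · simp [degIn, adjRow]
  · refine List.map_congr_left fun u _ => ?_
    by_cases h : G.Adj u v
    · simp [degIn, adjRow, h, h.symm]
    · simp [degIn, adjRow, h, mt SimpleGraph.Adj.symm h]

variable [DecidableEq V]

/-- The symmetric matrix with prescribed values on the diagonal, on edges and on non-edges. -/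
noncomputable def weightMatrix (diag on off : Zsqrtd 5) : Matrix V V ℝ :=
  Matrix.of fun v u => if v = u then val diag else if G.Adj v u then val on else val off

/-- The finitely supported vector with the given coordinates at the given vertices. -/
def listVec : List V → List ℝ → V → ℝ
  | v :: vs, x :: xs => Pi.single v x + listVec vs xs
  | _, _ => 0

theorem listVec_of_notMem : ∀ (vs : List V) (xs : List ℝ) (u : V), u ∉ vs → listVec vs xs u = 0
  | [], _, _, _ => rfl
  | _ :: _, [], _, _ => rfl
  | v :: vs, x :: xs, u, h => by
    rw [List.mem_cons, not_or] at h
    simp [listVec, Pi.single_eq_of_ne h.1, listVec_of_notMem vs xs u h.2]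

theorem eq_zero_of_listVec_eq_zero : ∀ (vs : List V) (xs : List ℝ), vs.Nodup →
    xs.length = vs.length → listVec vs xs = 0 → ∀ x ∈ xs, x = 0
  | _, [], _, _, _ => by simp
  | v :: vs, x :: xs, hn, hl, h => by
    rw [List.nodup_cons] at hn
    have hx : x = 0 := by
      simpa [listVec, listVec_of_notMem vs xs v hn.1] using congrFun h v
    have := eq_zero_of_listVec_eq_zero vs xs hn.2 (by simpa using hl)
      (by simpa [listVec, hx] using h)
    simpa [hx] using this

theorem listVec_map (X : V → ℝ) : ∀ vs : List V, vs.Nodup → ∀ u ∈ vs, listVec vs (vs.map X) u = X u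
  | v :: vs, hn, u, hu => by
    rw [List.nodup_cons] at hn
    rw [List.map_cons, listVec, Pi.add_apply]
    by_cases h : u = v
    · subst h
      simp [listVec_of_notMem vs _ u hn.1]
    · rw [Pi.single_eq_of_ne h, zero_add]
      exact listVec_map X vs hn.2 u (by simpa [h] using hu)

theorem degIn_eq_card (vs : List V) (hn : vs.Nodup) (v : V) :
    degIn G vs v = (vs.toFinset.filter fun u => G.Adj v u).card := by
  rw [degIn, adjRow, List.count, List.countP_map, List.countP_eq_length_filter,
    ← List.toFinset_card_of_nodup (hn.filter _), List.toFinset_filter]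
  congr 1
  ext u
  simp

variable [Fintype V]

theorem linForm_adjRow (diag on off : Zsqrtd 5) (v : V) : ∀ (vs : List V) (xs : List ℝ), v ∉ vs →
    linForm ((adjRow G vs v).map fun b => if b then on else off) xs =
      (weightMatrix G diag on off).mulVec (listVec vs xs) v
  | [], _, _ => by simp [adjRow, linForm, listVec]
  | _ :: _, [], _ => by simp [adjRow, linForm, listVec]
  | u :: vs, x :: xs, h => by
    rw [List.mem_cons, not_or] at h
    have ih := linForm_adjRow diag on off v vs xs h.2
    simp only [adjRow, List.map_cons, linForm, listVec, Matrix.mulVec_add, Pi.add_apply,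
      Matrix.mulVec_single] at ih ⊢
    rw [ih]
    by_cases ha : G.Adj v u <;> simp [weightMatrix, h.1, ha]

theorem weightMatrix_symm (diag on off : Zsqrtd 5) (X Y : V → ℝ) :
    X ⬝ᵥ (weightMatrix G diag on off).mulVec Y = Y ⬝ᵥ (weightMatrix G diag on off).mulVec X := by
  rw [Matrix.dotProduct_mulVec, dotProduct_comm, ← Matrix.mulVec_transpose]
  congr 2
  ext u v
  simp [weightMatrix, eq_comm, G.adj_comm]

theorem quadForm_gram_adjRows (diag on off : Zsqrtd 5) : ∀ (vs : List V) (xs : List ℝ), vs.Nodup →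
    quadForm (gram diag on off (adjRows G vs)) xs =
      listVec vs xs ⬝ᵥ (weightMatrix G diag on off).mulVec (listVec vs xs)
  | [], _, _ => by simp [adjRows, gram, quadForm, listVec]
  | _ :: _, [], _ => by simp [adjRows, gram, quadForm, listVec]
  | v :: vs, x :: xs, h => by
    rw [List.nodup_cons] at h
    have ih := quadForm_gram_adjRows diag on off vs xs h.2
    have hl := linForm_adjRow G diag on off v vs xs h.1
    simp only [adjRows, gram, List.map_cons, quadForm] at ih ⊢
    rw [ih, hl, listVec, Matrix.mulVec_add, add_dotProduct, dotProduct_add, dotProduct_add,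
      weightMatrix_symm G _ _ _ (listVec vs xs) (Pi.single v x)]
    simp [single_dotProduct, weightMatrix]
    ring

theorem posDefTest_gram_adjRows (diag on off : Zsqrtd 5)
    (hpos : ∀ X : V → ℝ, X ≠ 0 → (∃ u, X u = 0) →
      0 < X ⬝ᵥ (weightMatrix G diag on off).mulVec X)
    (vs : List V) (hn : vs.Nodup) (hl : vs.length < Fintype.card V) (k : ℕ) :
    posDefTest k (gram diag on off (adjRows G vs)) = true := by
  refine posDefTest_of_pos k _ (isTriangular_gram_adjRows G diag on off vs) fun xs hx hx0 => ?_
  rw [quadForm_gram_adjRows G diag on off vs xs hn]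
  obtain ⟨x, hx1, hx2⟩ := hx0
  refine hpos _ (fun h0 => hx2 (eq_zero_of_listVec_eq_zero vs xs hn ?_ h0 x hx1)) ?_
  · simpa [gram, length_adjRows] using hx
  · have : ∃ u, u ∉ vs := by
      by_contra! hc
      have := Finset.card_le_card (fun u _ => List.mem_toFinset.2 (hc u) :
        Finset.univ ⊆ vs.toFinset)
      rw [List.toFinset_card_of_nodup hn, Finset.card_univ] at this
      omega
    obtain ⟨u, hu⟩ := this
    exact ⟨u, listVec_of_notMem vs xs u hu⟩

theorem nonneg_of_psdTest (diag on off : Zsqrtd 5) (vs : List V) (hn : vs.Nodup)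
    (hl : Fintype.card V ≤ vs.length) (k : ℕ)
    (h : psdTest k (gram diag on off (adjRows G vs)) = true) (X : V → ℝ) :
    0 ≤ X ⬝ᵥ (weightMatrix G diag on off).mulVec X := by
  have hmem : ∀ u, u ∈ vs := by
    have : vs.toFinset = Finset.univ := by
      rw [← Finset.card_eq_iff_eq_univ, List.toFinset_card_of_nodup hn]
      exact le_antisymm hn.length_le_card hl
    intro u
    rw [← List.mem_toFinset, this]
    exact Finset.mem_univ u
  have h1 := quadForm_nonneg_of_psdTest k _ (isTriangular_gram_adjRows G diag on off vs) h
    (vs.map X)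
  rwa [quadForm_gram_adjRows G diag on off vs _ hn,
    show listVec vs (vs.map X) = X from funext fun u => listVec_map X vs hn u (hmem u)] at h1

theorem degIn_le_degree (vs : List V) (hn : vs.Nodup) (v : V) : degIn G vs v ≤ G.degree v := by
  rw [degIn_eq_card G vs hn, ← G.card_neighborFinset_eq_degree]
  refine Finset.card_le_card fun u hu => ?_
  simpa using (Finset.mem_filter.1 hu).2

theorem degIn_lt_degree (vs : List V) (hn : vs.Nodup) {u v : V} (hv : v ∉ vs) (h : G.Adj u v) :
    degIn G vs u < G.degree u := by
  rw [degIn_eq_card G vs hn, ← G.card_neighborFinset_eq_degree]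
  refine Finset.card_lt_card (Finset.ssubset_iff_subset_ne.2 ⟨fun w hw => ?_, fun he => hv ?_⟩)
  · simpa using (Finset.mem_filter.1 hw).2
  · have : v ∈ G.neighborFinset u := by simpa using h
    rw [← he] at this
    simpa using (Finset.mem_filter.1 this).1

theorem exists_adj_of_degIn_lt (vs : List V) (hn : vs.Nodup) {u : V}
    (h : degIn G vs u < G.degree u) : ∃ v, v ∉ vs ∧ G.Adj u v := by
  by_contra! hc
  refine h.not_ge ?_
  rw [degIn_eq_card G vs hn, ← G.card_neighborFinset_eq_degree]
  refine Finset.card_le_card fun w hw => ?_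
  have hw' : G.Adj u w := by simpa using hw
  exact Finset.mem_filter.2 ⟨List.mem_toFinset.2 (by_contra fun hm => hc w hm hw'), hw'⟩

theorem degree_le_degIn_add (vs : List V) (hn : vs.Nodup) (u : V) :
    G.degree u ≤ degIn G vs u + (Fintype.card V - vs.length) := by
  rw [degIn_eq_card G vs hn, ← G.card_neighborFinset_eq_degree, ← List.toFinset_card_of_nodup hn,
    ← Finset.card_compl]
  refine le_trans (Finset.card_le_card fun w hw => ?_) (Finset.card_union_le _ _)
  have hw' : G.Adj u w := by simpa using hw
  by_cases hm : w ∈ vs <;> simp [hm, hw']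

/-- The newest vertex was chosen with the largest key among the vertices hitting the oldest vertex
of deficient degree. -/
def IsMaxChoice (prev : List ℕ) (vs : List V) : Prop :=
  ∀ v, v ∉ vs → hits prev (adjRow G vs.tail v) = true →
    rowKey (adjRow G vs.tail v) ≤ rowKey ((adjRows G vs).headD [])

theorem search_ne_true (hconn : G.Connected) (hreg : G.IsRegularOfDegree 4) (N : ℕ)
    (full : Bool) (hN : N ≤ Fintype.card V) (hex : full = true → Fintype.card V = N)
    (hpos : ∀ X : V → ℝ, X ≠ 0 → (∃ u, X u = 0) →
      0 < X ⬝ᵥ (weightMatrix G ⟨5 - N, N - 1⟩ ⟨5 - N, -1⟩ ⟨5, -1⟩).mulVec X)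
    (hneg : ∃ X : V → ℝ,
      full = true → X ⬝ᵥ (weightMatrix G ⟨N + 3, 0⟩ ⟨3 - N, 0⟩ ⟨3, 0⟩).mulVec X < 0) :
    ∀ (m : ℕ) (vs : List V) (prev : List ℕ), vs.Nodup → vs ≠ [] → vs.length + m = N →
      IsMaxChoice G prev vs →
      search N full m (adjRows G vs) (vs.map (degIn G vs)) prev ≠ true := by
  intro m
  induction m with
  | zero =>
    intro vs prev hn _ hl _ hs
    simp only [search, Bool.and_eq_true] at hs
    obtain ⟨X, hX⟩ := hneg
    have := nonneg_of_psdTest G _ _ _ vs hn (by rw [hex hs.1]; omega) N hs.2 X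
    exact (hX hs.1).not_ge this
  | succ m ih =>
    intro vs prev hn hne hl hmax hs
    rw [search, Bool.or_eq_true] at hs
    have hdef : ∃ u ∈ vs, degIn G vs u ≠ 4 := by
      by_contra! hc
      have hall := mem_of_closed G hconn vs hne fun u hu v huv => by
        by_contra hv
        have := degIn_lt_degree G vs hn hv huv
        rw [hc u hu, hreg u] at this
        omega
      have := Finset.card_le_card (fun u _ => List.mem_toFinset.2 (hall u) :
        Finset.univ ⊆ vs.toFinset)
      rw [List.toFinset_card_of_nodup hn, Finset.card_univ] at this
      omega
    obtain ⟨f, hf, hf4, hhit⟩ := exists_hits_iff (degIn G vs) vs hdef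
    replace hs := hs.resolve_left fun hc => by
      rw [List.all_eq_true] at hc
      exact hf4 (by simpa using hc _ (List.mem_map_of_mem hf))
    have hflt : degIn G vs f < G.degree f :=
      lt_of_le_of_ne (degIn_le_degree G vs hn f) (by rwa [hreg f])
    obtain ⟨v₀, hv₀, hfv₀⟩ := exists_adj_of_degIn_lt G vs hn hflt
    obtain ⟨v, hv, hvmax⟩ := Finset.exists_max_image
      (Finset.univ.filter fun v => v ∉ vs ∧ hits (vs.map (degIn G vs)) (adjRow G vs v) = true)
      (fun v => rowKey (adjRow G vs v)) ⟨v₀, by simp [hv₀, adjRow, hhit, hfv₀.symm]⟩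
    simp only [Finset.mem_filter, Finset.mem_univ, true_and] at hv hvmax
    have hn' : (v :: vs).Nodup := List.nodup_cons.2 ⟨hv.1, hn⟩
    have hmem : adjRow G vs v ∈ freeRows (vs.map (degIn G vs)) :=
      map_mem_freeRows _ _ vs fun u _ huv => by
        rw [← hreg u]
        exact degIn_lt_degree G vs hn hv.1 (G.adj_symm (of_decide_eq_true huv))
    have htail : ∀ w, (adjRow G vs w).tail = adjRow G vs.tail w := fun w => by
      simp [adjRow, List.map_tail]
    have hs := List.all_eq_true.1 hs _ hmem
    simp only [← map_degIn_cons, Bool.or_eq_true, Bool.and_eq_true, Bool.not_eq_true',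
      decide_eq_true_eq, htail] at hs
    rcases hs with ((hs | hs) | hs) | ((hs | hs) | hs)
    · rw [hv.2] at hs
      exact absurd hs (by simp)
    · have := degIn_le_degree G vs hn v
      rw [hreg v, degIn] at this
      omega
    · exact (hmax v hv.1 hs.1).not_gt hs.2
    · obtain ⟨hs1, hs2⟩ := hs
      rw [List.any_eq_true] at hs2
      obtain ⟨d, hd, hdm⟩ := hs2
      obtain ⟨u, _, rfl⟩ := List.mem_map.1 hd
      have := degree_le_degIn_add G (v :: vs) hn' u
      rw [hreg u, hex hs1, List.length_cons] at this
      have hdm := of_decide_eq_true hdm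
      omega
    · have := posDefTest_gram_adjRows G _ _ _ hpos (v :: vs) hn'
        (by rw [List.length_cons]; omega) N
      rw [adjRows] at this
      rw [thetaGram, this] at hs
      exact absurd hs.2 (by simp)
    · refine ih (v :: vs) _ hn' (by simp) (by rw [List.length_cons]; omega) ?_ hs
      intro w hw hwh
      exact hvmax w ⟨fun h => hw (by simp [h]), hwh⟩

end Graph

section Spectral

variable {V : Type*} [Fintype V] (G : SimpleGraph V) [DecidableRel G.Adj]

theorem dotProduct_adjMatrix_symm (x y : V → ℝ) :
    x ⬝ᵥ (G.adjMatrix ℝ).mulVec y = (G.adjMatrix ℝ).mulVec x ⬝ᵥ y := by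
  rw [Matrix.dotProduct_mulVec, ← Matrix.mulVec_transpose, G.transpose_adjMatrix]

theorem adjMatrix_mulVec_one (hreg : G.IsRegularOfDegree 4) :
    (G.adjMatrix ℝ).mulVec 1 = (4 : ℝ) • (1 : V → ℝ) := by
  ext v
  simp [SimpleGraph.adjMatrix_mulVec_apply, hreg v]

variable [DecidableEq V]

theorem exists_eigenvector_expansion :
    ∃ e : V → V → ℝ,
      (∀ i, (G.adjMatrix ℝ).mulVec (e i) = (adjMatrix_isHermitian G).eigenvalues i • e i) ∧
      (∀ i j, e i ⬝ᵥ e j = if i = j then 1 else 0) ∧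
      ∀ x y : V → ℝ, x ⬝ᵥ y = ∑ i, (x ⬝ᵥ e i) * (e i ⬝ᵥ y) := by
  set hA := adjMatrix_isHermitian G
  have hinner : ∀ x y : EuclideanSpace ℝ V, inner ℝ x y = x.ofLp ⬝ᵥ y.ofLp := fun x y => by
    rw [EuclideanSpace.inner_eq_star_dotProduct, dotProduct_comm]
    simp
  refine ⟨fun i => (hA.eigenvectorBasis i).ofLp, fun i => ?_, fun i j => ?_, fun x y => ?_⟩
  · simpa using hA.mulVec_eigenvectorBasis i
  · rw [← hinner, OrthonormalBasis.inner_eq_ite]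
  · have := hA.eigenvectorBasis.sum_inner_mul_inner (WithLp.toLp 2 x) (WithLp.toLp 2 y)
    simpa only [hinner] using this.symm

theorem exists_index_secondEigenvalue (hcard : 2 ≤ Fintype.card V) :
    ∃ i j, i ≠ j ∧ (adjMatrix_isHermitian G).eigenvalues j = secondEigenvalue G ∧
      secondEigenvalue G ≤ (adjMatrix_isHermitian G).eigenvalues i ∧
      ∀ k, k ≠ i → (adjMatrix_isHermitian G).eigenvalues k ≤ secondEigenvalue G := by
  set μ := (adjMatrix_isHermitian G).eigenvalues
  set l := (eigMultiset G).sort (· ≤ ·) with hl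
  have hlen : l.length = Fintype.card V := by
    rw [hl, Multiset.length_sort, eigMultiset, Multiset.card_map]
    rfl
  have hsort : l.Pairwise (· ≤ ·) := Multiset.pairwise_sort _ _
  obtain ⟨t, a, b, htab⟩ : ∃ t a b, l = t ++ [a, b] := by
    have hd : (l.drop (l.length - 2)).length = 2 := by
      rw [List.length_drop]
      omega
    obtain ⟨a, b, hab⟩ := List.length_eq_two.1 hd
    exact ⟨l.take (l.length - 2), a, b, by rw [← hab, List.take_append_drop]⟩
  have hsec : secondEigenvalue G = a := by
    rw [secondEigenvalue, ← hl, htab]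
    simp
  rw [htab, List.pairwise_append] at hsort
  have hab : a ≤ b := by simpa using hsort.2.1
  have hmul : Multiset.map μ Finset.univ.val = b ::ₘ a ::ₘ (t : Multiset ℝ) := by
    have h1 : ((l : List ℝ) : Multiset ℝ) = Multiset.map μ Finset.univ.val :=
      Multiset.sort_eq _ _
    rw [← h1, htab, Multiset.cons_coe, Multiset.cons_coe, Multiset.coe_eq_coe]
    exact List.perm_append_comm.trans (List.Perm.swap _ _ _)
  obtain ⟨i, _, hi⟩ : ∃ i ∈ Finset.univ.val, μ i = b :=
    Multiset.mem_map.1 (by rw [hmul]; simp)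
  have herase : Multiset.map μ (Finset.univ.erase i).val = a ::ₘ (t : Multiset ℝ) := by
    have h2 : (Finset.univ : Finset V).val = i ::ₘ (Finset.univ.erase i).val := by
      rw [Finset.erase_val, Multiset.cons_erase (Finset.mem_univ i)]
    rw [h2, Multiset.map_cons, hi] at hmul
    exact (Multiset.cons_inj_right b).1 hmul
  obtain ⟨j, hj, hja⟩ : ∃ j ∈ (Finset.univ.erase i).val, μ j = a :=
    Multiset.mem_map.1 (by rw [herase]; simp)
  refine ⟨i, j, (Finset.ne_of_mem_erase hj).symm, by rw [hja, hsec], by rwa [hi, hsec],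
    fun k hk => ?_⟩
  have hk' : μ k ∈ a ::ₘ (t : Multiset ℝ) := by
    rw [← herase]
    exact Multiset.mem_map_of_mem μ (Finset.mem_erase.2 ⟨hk, Finset.mem_univ k⟩)
  rw [hsec]
  rcases Multiset.mem_cons.1 hk' with h | h
  · exact h.le
  · exact hsort.2.2 _ (by simpa using h) a (by simp)

theorem quadratic_le_secondEigenvalue (hcard : 2 ≤ Fintype.card V)
    (hreg : G.IsRegularOfDegree 4) (hlt : secondEigenvalue G < 4) (x : V → ℝ)
    (hx : ∑ v, x v = 0) :
    x ⬝ᵥ (G.adjMatrix ℝ).mulVec x ≤ secondEigenvalue G * (x ⬝ᵥ x) := by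
  obtain ⟨e, he, -, hsum⟩ := exists_eigenvector_expansion G
  obtain ⟨i, j, -, -, -, hle⟩ := exists_index_secondEigenvalue G hcard
  set A := G.adjMatrix ℝ
  set μ := (adjMatrix_isHermitian G).eigenvalues
  set c := secondEigenvalue G
  have hperp : ∀ y : V → ℝ, y ⬝ᵥ e i = 0 → y ⬝ᵥ A.mulVec y ≤ c * (y ⬝ᵥ y) := by
    intro y hy
    rw [hsum y (A.mulVec y), hsum y y, Finset.mul_sum]
    refine Finset.sum_le_sum fun k _ => ?_
    rw [dotProduct_adjMatrix_symm, he, smul_dotProduct, smul_eq_mul, dotProduct_comm (e k) y]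
    by_cases hk : k = i
    · simp [hk, hy]
    · nlinarith [hle k hk, mul_self_nonneg (y ⬝ᵥ e k)]
  have h1x : (1 : V → ℝ) ⬝ᵥ x = 0 := by simpa [dotProduct] using hx
  have hx1 : x ⬝ᵥ (1 : V → ℝ) = 0 := by rwa [dotProduct_comm]
  have h1A : (1 : V → ℝ) ⬝ᵥ A.mulVec x = 0 := by
    rw [dotProduct_adjMatrix_symm, adjMatrix_mulVec_one G hreg, smul_dotProduct, h1x, smul_zero]
  have h11 : (0 : ℝ) < (1 : V → ℝ) ⬝ᵥ 1 := by
    simp [dotProduct]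
    omega
  by_contra! hcon
  set a := x ⬝ᵥ e i
  set b := -((1 : V → ℝ) ⬝ᵥ e i)
  have h := hperp (a • 1 + b • x) (by
    rw [add_dotProduct, smul_dotProduct, smul_dotProduct, smul_eq_mul, smul_eq_mul]
    ring)
  simp only [Matrix.mulVec_add, Matrix.mulVec_smul, add_dotProduct, dotProduct_add,
    smul_dotProduct, dotProduct_smul, smul_eq_mul, h1x, hx1, h1A,
    A, adjMatrix_mulVec_one G hreg] at h
  have ha : a = 0 := by
    by_contra ha
    have : 0 < a ^ 2 := by positivity
    nlinarith [mul_pos this (mul_pos (sub_pos.2 hlt) h11),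
      mul_nonneg (sq_nonneg b) (sub_pos.2 hcon).le]
  exact hcon.not_ge (hperp x ha)

theorem exists_quadratic_gt (hcard : 2 ≤ Fintype.card V) (hgt : 1 < secondEigenvalue G) :
    ∃ y : V → ℝ, ∑ v, y v = 0 ∧ y ⬝ᵥ y < y ⬝ᵥ (G.adjMatrix ℝ).mulVec y := by
  obtain ⟨e, he, horth, -⟩ := exists_eigenvector_expansion G
  obtain ⟨i, j, hij, hj, hi, -⟩ := exists_index_secondEigenvalue G hcard
  have key : ∀ a b : ℝ, (a ≠ 0 ∨ b ≠ 0) → a * ((1 : V → ℝ) ⬝ᵥ e i) + b * (1 ⬝ᵥ e j) = 0 →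
      ∃ y : V → ℝ, ∑ v, y v = 0 ∧ y ⬝ᵥ y < y ⬝ᵥ (G.adjMatrix ℝ).mulVec y := by
    intro a b hab h0
    refine ⟨a • e i + b • e j, ?_, ?_⟩
    · have : (1 : V → ℝ) ⬝ᵥ (a • e i + b • e j) = 0 := by
        rw [dotProduct_add, dotProduct_smul, dotProduct_smul]
        exact h0
      simpa [dotProduct] using this
    · simp only [Matrix.mulVec_add, Matrix.mulVec_smul, he, add_dotProduct, dotProduct_add,
        smul_dotProduct, dotProduct_smul, smul_eq_mul, horth, hij, hij.symm, if_true, if_false]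
      rw [hj]
      have h1 := sub_pos.2 (hgt.trans_le hi)
      have h2 := sub_pos.2 hgt
      rcases hab with ha | hb
      · nlinarith [mul_pos (by positivity : 0 < a ^ 2) h1, mul_nonneg (sq_nonneg b) h2.le]
      · nlinarith [mul_pos (by positivity : 0 < b ^ 2) h2, mul_nonneg (sq_nonneg a) h1.le]
  by_cases h : (1 : V → ℝ) ⬝ᵥ e i = 0
  · exact key 1 0 (Or.inl one_ne_zero) (by simp [h])
  · exact key (-(1 ⬝ᵥ e j)) (1 ⬝ᵥ e i) (Or.inr h) (by ring)

theorem weightMatrix_quadratic (diag on off : Zsqrtd 5) (x : V → ℝ) :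
    x ⬝ᵥ (weightMatrix G diag on off).mulVec x =
      (val diag - val off) * (x ⬝ᵥ x) +
        (val on - val off) * (x ⬝ᵥ (G.adjMatrix ℝ).mulVec x) + val off * (∑ v, x v) ^ 2 := by
  have h : weightMatrix G diag on off = (val diag - val off) • (1 : Matrix V V ℝ) +
      (val on - val off) • G.adjMatrix ℝ + val off • Matrix.of fun _ _ => 1 := by
    ext u v
    by_cases huv : u = v
    · subst huv
      simp [weightMatrix]
    · by_cases ha : G.Adj u v <;> simp [weightMatrix, huv, ha]
  have hJ : x ⬝ᵥ (Matrix.of fun _ _ : V => (1 : ℝ)).mulVec x = (∑ v, x v) ^ 2 := by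
    simp [dotProduct, Matrix.mulVec, ← Finset.sum_mul, sq]
  rw [h, Matrix.add_mulVec, Matrix.add_mulVec, Matrix.smul_mulVec, Matrix.smul_mulVec,
    Matrix.smul_mulVec, Matrix.one_mulVec, dotProduct_add, dotProduct_add, dotProduct_smul,
    dotProduct_smul, dotProduct_smul, hJ]
  simp only [smul_eq_mul]

theorem weightMatrix_pos (hcard : 2 ≤ Fintype.card V) (hreg : G.IsRegularOfDegree 4)
    (hlt : secondEigenvalue G < Real.sqrt 5 - 1) (N : ℕ) (hN0 : 0 < N)
    (hN : N ≤ Fintype.card V) (x : V → ℝ) (hx : x ≠ 0) (hx0 : ∃ u, x u = 0) :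
    0 < x ⬝ᵥ (weightMatrix G ⟨5 - N, N - 1⟩ ⟨5 - N, -1⟩ ⟨5, -1⟩).mulVec x := by
  have h5 : Real.sqrt 5 < 3 := by
    rw [Real.sqrt_lt' (by norm_num)]
    norm_num
  obtain ⟨n, hn⟩ : ∃ n : ℝ, n = Fintype.card V := ⟨_, rfl⟩
  have hn0 : 0 < n := by
    rw [hn]
    exact_mod_cast (by omega : 0 < Fintype.card V)
  set m : ℝ := (∑ v, x v) / n with hm
  have hmn : ∑ v, x v = m * n := by
    rw [hm]
    field_simp
  set y : V → ℝ := x - m • 1 with hy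
  have hxy : x = m • 1 + y := by rw [hy]; abel
  have hy0 : ∑ v, y v = 0 := by
    simp [hy, Finset.sum_sub_distrib, hmn, ← hn]
    ring
  have h1y : (1 : V → ℝ) ⬝ᵥ y = 0 := by simpa [dotProduct] using hy0
  have hy1 : y ⬝ᵥ (1 : V → ℝ) = 0 := by rwa [dotProduct_comm]
  have h11 : (1 : V → ℝ) ⬝ᵥ 1 = n := by simp [dotProduct, hn]
  have h1A : (1 : V → ℝ) ⬝ᵥ (G.adjMatrix ℝ).mulVec y = 0 := by
    rw [dotProduct_adjMatrix_symm, adjMatrix_mulVec_one G hreg, smul_dotProduct, h1y, smul_zero]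
  have hyne : y ≠ 0 := by
    intro h0
    obtain ⟨u, hu⟩ := hx0
    rw [h0, add_zero] at hxy
    rw [hxy] at hu
    have hm0 : m = 0 := by simpa using hu
    rw [hm0, zero_smul] at hxy
    exact hx hxy
  have hyy : 0 < y ⬝ᵥ y := by
    simpa using Matrix.dotProduct_star_self_pos_iff.2 hyne
  have hle := quadratic_le_secondEigenvalue G hcard hreg (by linarith) y hy0
  have hq : x ⬝ᵥ (G.adjMatrix ℝ).mulVec x = 4 * n * m ^ 2 + y ⬝ᵥ (G.adjMatrix ℝ).mulVec y := by
    rw [hxy]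
    simp only [Matrix.mulVec_add, Matrix.mulVec_smul, add_dotProduct, dotProduct_add,
      smul_dotProduct, dotProduct_smul, smul_eq_mul, hy1, h11, h1A,
      adjMatrix_mulVec_one G hreg]
    ring
  have hxx : x ⬝ᵥ x = n * m ^ 2 + y ⬝ᵥ y := by
    rw [hxy]
    simp only [add_dotProduct, dotProduct_add, smul_dotProduct, dotProduct_smul, smul_eq_mul,
      h1y, hy1, h11]
    ring
  rw [weightMatrix_quadratic, hq, hxx, hmn]
  have hN' : (N : ℝ) ≤ n := by rw [hn]; exact_mod_cast hN
  have hN0' : (0 : ℝ) < N := by exact_mod_cast hN0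
  have e1 : 0 ≤ (5 - Real.sqrt 5) * (n * m ^ 2 * (n - N)) :=
    mul_nonneg (by linarith) (mul_nonneg (by positivity) (by linarith))
  have e2 : 0 < N * ((Real.sqrt 5 - 1 - secondEigenvalue G) * (y ⬝ᵥ y)) :=
    mul_pos hN0' (mul_pos (by linarith) hyy)
  have e3 : 0 ≤ N * (secondEigenvalue G * (y ⬝ᵥ y) - y ⬝ᵥ (G.adjMatrix ℝ).mulVec y) :=
    mul_nonneg hN0'.le (by linarith)
  simp only [val]
  push_cast
  nlinarith [e1, e2, e3]

theorem exists_weightMatrix_neg (hcard : 2 ≤ Fintype.card V) (hgt : 1 < secondEigenvalue G) :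
    ∃ x : V → ℝ, x ⬝ᵥ (weightMatrix G ⟨Fintype.card V + 3, 0⟩ ⟨3 - Fintype.card V, 0⟩
      ⟨3, 0⟩).mulVec x < 0 := by
  obtain ⟨y, hy0, hy⟩ := exists_quadratic_gt G hcard hgt
  refine ⟨y, ?_⟩
  have hn : (0 : ℝ) < Fintype.card V := by exact_mod_cast (by omega : 0 < Fintype.card V)
  rw [weightMatrix_quadratic, hy0]
  simp only [val]
  push_cast
  nlinarith [mul_pos hn (sub_pos.2 hy)]

theorem search_initial_ne_true (hconn : G.Connected) (hreg : G.IsRegularOfDegree 4)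
    (hcard : 2 ≤ Fintype.card V) (hgt : 1 < secondEigenvalue G)
    (hlt : secondEigenvalue G < Real.sqrt 5 - 1) (N : ℕ) (full : Bool)
    (hN : N + 1 ≤ Fintype.card V) (hex : full = true → Fintype.card V = N + 1) :
    search (N + 1) full N [[]] [0] [] ≠ true := by
  obtain ⟨v⟩ := hconn.nonempty
  have h := search_ne_true G hconn hreg (N + 1) full hN hex
    (weightMatrix_pos G hcard hreg hlt (N + 1) (by omega) hN)
    (by
      obtain ⟨x, hx⟩ := exists_weightMatrix_neg G hcard hgt
      exact ⟨x, fun h => by rwa [← hex h]⟩)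
    N [v] [] (by simp) (by simp) (by simp [add_comm]) (fun w _ hw => by simp [hits] at hw)
  simpa [adjRows, adjRow, degIn] using h

end Spectral

set_option maxRecDepth 100000 in
theorem search_exact : ∀ N < 12, 4 ≤ N → search (N + 1) true N [[]] [0] [] = true := by
  decide +kernel

set_option maxRecDepth 100000 in
theorem search_thirteen : search 13 false 12 [[]] [0] [] = true := by
  decide +kernel

end RegularSearch

theorem stmt18 {V : Type*} [Fintype V] [DecidableEq V] (G : SimpleGraph V) [DecidableRel G.Adj]
    (hconn : G.Connected) (hreg : G.IsRegularOfDegree 4)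
    (hlam : 1 < secondEigenvalue G) :
    Real.sqrt 5 - 1 ≤ secondEigenvalue G := by
  by_contra! hlt
  have hcard : 5 ≤ Fintype.card V := by
    obtain ⟨v⟩ := hconn.nonempty
    have := G.degree_lt_card_verts v
    rw [hreg v] at this
    omega
  by_cases h : Fintype.card V ≤ 12
  · exact RegularSearch.search_initial_ne_true G hconn hreg (by omega) hlam hlt
      (Fintype.card V - 1) true (by omega) (fun _ => by omega)
      (RegularSearch.search_exact _ (by omega) (by omega))
  · exact RegularSearch.search_initial_ne_true G hconn hreg (by omega) hlam hlt 12 false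
      (by omega) (by simp) RegularSearch.search_thirteen
end

section
/- Every connected 3-regular finite simple graph G whose second largest adjacency eigenvalue satisfies λ₂(G) ≤ 1.9 has at most 18 vertices. -/
open Polynomial

section

open scoped Matrix

variable {V : Type*} [Fintype V] [DecidableEq V] {G : SimpleGraph V} [DecidableRel G.Adj]

theorem card_filter_lt_le_one (s : Multiset ℝ) {a : ℝ}
    (h : (s.sort (· ≤ ·)).getD ((s.sort (· ≤ ·)).length - 2) 0 ≤ a) :
    (s.filter (a < ·)).card ≤ 1 := by
  set l := s.sort (· ≤ ·)
  have hs : s = (l : Multiset ℝ) := (Multiset.sort_eq s _).symm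
  have hp : l.Pairwise (· ≤ ·) := Multiset.pairwise_sort s _
  rw [hs, Multiset.filter_coe, Multiset.coe_card, ← List.take_append_drop (l.length - 1) l,
    List.filter_append, List.length_append]
  have h₁ : (l.take (l.length - 1)).filter (fun b => decide (a < b)) = [] := by
    rw [List.filter_eq_nil_iff]
    intro b hb
    rw [decide_eq_true_eq, not_lt]
    obtain ⟨i, hi, rfl⟩ := List.mem_iff_getElem.1 hb
    rw [List.length_take] at hi
    rw [List.getElem_take]
    refine le_trans ?_ h
    have hlt : l.length - 2 < l.length := by omega
    rw [List.getD_eq_getElem _ _ hlt]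
    rcases (show i ≤ l.length - 2 by omega).eq_or_lt with he | hlt'
    · simp [he]
    · exact List.pairwise_iff_getElem.1 hp _ _ _ _ hlt'
  rw [h₁, List.length_nil, zero_add]
  refine (List.length_filter_le _ _).trans ?_
  rw [List.length_drop]
  omega

theorem eigenvalues_le_of_ne {a : ℝ} (h : secondEigenvalue G ≤ a) {i j : V}
    (hi : a < (adjMatrix_isHermitian G).eigenvalues i) (hij : j ≠ i) :
    (adjMatrix_isHermitian G).eigenvalues j ≤ a := by
  by_contra! hj
  have := card_filter_lt_le_one _ h
  rw [eigMultiset, Multiset.filter_map, Multiset.card_map] at this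
  change (Finset.univ.filter fun k => a < (adjMatrix_isHermitian G).eigenvalues k).card ≤ 1 at this
  exact hij (Finset.card_le_one.1 this j (by simpa using hj) i (by simpa using hi))

/-- On the orthogonal complement of the constants the quadratic form of the adjacency matrix is
bounded by the second eigenvalue. -/
theorem dotProduct_adjMatrix_mulVec_le {d : ℕ} (hreg : G.IsRegularOfDegree d) {a : ℝ}
    (had : a < d) (h : secondEigenvalue G ≤ a) {y : V → ℝ} (hy : ∑ v, y v = 0) :
    y ⬝ᵥ G.adjMatrix ℝ *ᵥ y ≤ a * y ⬝ᵥ y := by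
  rcases isEmpty_or_nonempty V with hV | hV
  · simp [dotProduct]
  set A := G.adjMatrix ℝ
  have hA : A.IsHermitian := adjMatrix_isHermitian G
  set b := hA.eigenvectorBasis
  have hsymm : ∀ x z : V → ℝ, (A *ᵥ x) ⬝ᵥ z = x ⬝ᵥ A *ᵥ z := fun x z => by
    rw [Matrix.dotProduct_mulVec, ← Matrix.mulVec_transpose, G.isSymm_adjMatrix]
  have hexp : ∀ x z : V → ℝ, x ⬝ᵥ z = ∑ i, (x ⬝ᵥ ⇑(b i)) * (z ⬝ᵥ ⇑(b i)) := by
    intro x z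
    have := b.sum_inner_mul_inner (WithLp.toLp 2 x) (WithLp.toLp 2 z)
    simp only [EuclideanSpace.inner_eq_star_dotProduct, star_trivial] at this
    rw [dotProduct_comm x z, ← this]
    exact Finset.sum_congr rfl fun i _ => by rw [dotProduct_comm x]
  have hcoef : ∀ (x : V → ℝ) i, (A *ᵥ x) ⬝ᵥ ⇑(b i) = hA.eigenvalues i * x ⬝ᵥ ⇑(b i) := by
    intro x i
    rw [hsymm, hA.mulVec_eigenvectorBasis, dotProduct_smul, smul_eq_mul]
  have hone : A *ᵥ (fun _ => 1) = (d : ℝ) • fun _ => 1 := by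
    ext v
    simp [A, SimpleGraph.adjMatrix_mulVec_apply, hreg v]
  have hzero : ∀ i, hA.eigenvalues i ≠ d → (fun _ => 1 : V → ℝ) ⬝ᵥ ⇑(b i) = 0 := by
    intro i hi
    have := hcoef (fun _ => 1) i
    rw [hone, smul_dotProduct, smul_eq_mul] at this
    exact (mul_eq_zero.1 (by linear_combination -this :
      (hA.eigenvalues i - d) * (fun _ => 1 : V → ℝ) ⬝ᵥ ⇑(b i) = 0)).resolve_left (sub_ne_zero.2 hi)
  obtain ⟨i, hi⟩ : ∃ i, hA.eigenvalues i = d := by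
    by_contra! hne
    have := hexp (fun _ => 1) (fun _ => 1)
    rw [Finset.sum_eq_zero fun i _ => by rw [hzero i (hne i), zero_mul]] at this
    simp [dotProduct] at this
  have hother : ∀ j ≠ i, hA.eigenvalues j ≤ a := fun j hj =>
    eigenvalues_le_of_ne h (by rwa [← hi] at had) hj
  have hyi : y ⬝ᵥ ⇑(b i) = 0 := by
    have key : ∀ x : V → ℝ, x ⬝ᵥ (fun _ => 1) =
        (x ⬝ᵥ ⇑(b i)) * ((fun _ => 1 : V → ℝ) ⬝ᵥ ⇑(b i)) := fun x => by
      rw [hexp, Finset.sum_eq_single_of_mem i (Finset.mem_univ i)]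
      intro j _ hj
      rw [hzero j ((hother j hj).trans_lt had).ne, mul_zero]
    have h₁ := key fun _ => 1
    have h₂ := key y
    have h₃ : y ⬝ᵥ (fun _ => 1) = 0 := by simpa [dotProduct] using hy
    rw [h₃] at h₂
    refine (mul_eq_zero.1 h₂.symm).resolve_right fun h₄ => ?_
    rw [h₄] at h₁
    simp [dotProduct] at h₁
  rw [hexp, hexp y y, Finset.mul_sum]
  refine Finset.sum_le_sum fun j _ => ?_
  rw [hcoef]
  by_cases hj : j = i
  · rw [hj, hyi]
    simp
  · nlinarith [hother j hj, mul_self_nonneg (y ⬝ᵥ ⇑(b j))]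

theorem sum_mul_sum_neighborFinset_le [Nonempty V] {d : ℕ} (hreg : G.IsRegularOfDegree d) {a : ℝ}
    (had : a < d) (h : secondEigenvalue G ≤ a) (f : V → ℝ) :
    ∑ v, f v * ∑ w ∈ G.neighborFinset v, f w ≤
      a * ∑ v, f v * f v + (d - a) / Fintype.card V * ((∑ v, f v) * ∑ v, f v) := by
  have hn : (Fintype.card V : ℝ) ≠ 0 := by simp
  set n : ℝ := (Fintype.card V : ℝ)
  set c : ℝ := (∑ v, f v) / n with hc
  have hcn : ∑ v, f v = c * n := by rw [hc, div_mul_cancel₀ _ hn]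
  have hsum : ∑ v, (f v - c) = 0 := by
    rw [Finset.sum_sub_distrib, hcn]
    simp [n, mul_comm]
  have hle := dotProduct_adjMatrix_mulVec_le hreg had h hsum
  have hdouble : ∑ v, ∑ w ∈ G.neighborFinset v, f w = d * (c * n) := by
    simp_rw [← hcn, Finset.mul_sum, SimpleGraph.neighborFinset_eq_filter, Finset.sum_filter]
    rw [Finset.sum_comm]
    refine Finset.sum_congr rfl fun v _ => ?_
    simp_rw [G.adj_comm _ v]
    rw [← Finset.sum_filter, ← SimpleGraph.neighborFinset_eq_filter, Finset.sum_const,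
      SimpleGraph.card_neighborFinset_eq_degree, hreg v, nsmul_eq_mul]
  have h₁ : (fun v => f v - c) ⬝ᵥ G.adjMatrix ℝ *ᵥ (fun v => f v - c) =
      ∑ v, f v * ∑ w ∈ G.neighborFinset v, f w - d * c * (c * n) := by
    simp only [dotProduct, SimpleGraph.adjMatrix_mulVec_apply, Finset.sum_sub_distrib, sub_mul,
      mul_sub, Finset.sum_const, SimpleGraph.card_neighborFinset_eq_degree, hreg _, nsmul_eq_mul,
      ← Finset.mul_sum, ← Finset.sum_mul, hdouble, hcn, Finset.card_univ]
    ring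
  have h₂ : (fun v => f v - c) ⬝ᵥ (fun v => f v - c) = ∑ v, f v * f v - c * (c * n) := by
    simp only [dotProduct, Finset.sum_sub_distrib, sub_mul,
      mul_sub, Finset.sum_const, nsmul_eq_mul, ← Finset.mul_sum, ← Finset.sum_mul, hcn,
      Finset.card_univ]
    ring
  rw [h₁, h₂] at hle
  have h₃ : (d - a) / n * ((∑ v, f v) * ∑ v, f v) = (d - a) * c * (c * n) := by
    rw [hcn]
    field_simp
  rw [h₃]
  linarith

end

/-- A finite partial graph on `0, …, s.length - 1`, given by its neighbour lists. -/
abbrev PartialGraph := List (List ℕ)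

namespace PartialGraph

/-- The list of neighbours of `i`. -/
def row (s : PartialGraph) (i : ℕ) : List ℕ := s.getD i []

/-- Add the edge between `u` and `w`. -/
def addEdge (s : PartialGraph) (u w : ℕ) : PartialGraph :=
  (s.modify u (w :: ·)).modify w (u :: ·)

/-- Add a new vertex and join it to `u`. -/
def addLeaf (u : ℕ) (s : PartialGraph) : PartialGraph :=
  s.modify u (s.length :: ·) ++ [[u]]

/-- The bit mask of the vertices at distance at most `m` from `u`. -/
def ball (s : PartialGraph) (u : ℕ) : ℕ → ℕ
  | 0 => 1 <<< u
  | m + 1 => s.zipIdx.foldl (fun a p => bif (s.ball u m).testBit p.2 then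
      p.1.foldl (fun a j => a ||| 1 <<< j) a else a) (s.ball u m)

/-- The vertices of degree less than three which can be joined to `u` without creating a cycle
of length at most `m + 1`. -/
def candidates (m : ℕ) (s : PartialGraph) (u : ℕ) : List ℕ :=
  (s.zipIdx.filter fun p => decide (p.1.length < 3) && !(s.ball u m).testBit p.2).map Prod.snd

/-- The ways to attach further neighbours to `u`: either one further neighbour is an existing
vertex, or all the missing ones are new. -/
def extensions (m : ℕ) (s : PartialGraph) (u : ℕ) : List PartialGraph :=
  (s.candidates m u).map (s.addEdge u) ++ [(addLeaf u)^[3 - (s.row u).length] s]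

/-- The `i`-th digit of `x` in base `64`. -/
def digit (x i : ℕ) : ℕ := x / 64 ^ i % 64

/-- The `i`-th coordinate of the test vector encoded by `x` in base `64` with offset `32`. -/
def weight (x i : ℕ) : ℤ := Int.subNatNat (digit x i) 32

/-- The test vector encoded by `x` violates the quadratic form inequality in every cubic graph
containing `s`. -/
def violates (s : PartialGraph) (x : ℕ) : Bool :=
  (s.zipIdx.all fun p => decide (3 ≤ p.1.length) || decide (0 ≤ weight x p.2)) &&
  decide (1900 * (s.zipIdx.map fun p => weight x p.2 * weight x p.2).sum +
      55 * ((s.zipIdx.map fun p => weight x p.2).sum * (s.zipIdx.map fun p => weight x p.2).sum) <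
    1000 * (s.zipIdx.map fun p => weight x p.2 *
      Int.subNatNat (p.1.map (digit x)).sum (32 * p.1.length)).sum)

/-- Run a certificate against a stack of partial graphs. An odd token `2 * x + 1` discards the
top of the stack by means of the test vector `x`, an even token `2 * u` replaces it by its
extensions at `u`. -/
def refute (m : ℕ) : List ℕ → List PartialGraph → Bool
  | _, [] => true
  | [], _ :: _ => false
  | t :: ts, s :: stack =>
    if t % 2 = 1 then s.violates (t / 2) && refute m ts stack
    else decide (t / 2 < s.length) && (decide ((s.row (t / 2)).length < 3) &&
      refute m ts (s.extensions m (t / 2) ++ stack))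

/-- The cycle on `n` vertices. -/
def cycle (n : ℕ) : PartialGraph :=
  (List.range n).map fun i =>
    [if i = 0 then n - 1 else i - 1, if i + 1 = n then 0 else i + 1]

end PartialGraph

section

variable {V : Type*} {G : SimpleGraph V}

namespace PartialGraph

theorem row_of_length_le {s : PartialGraph} {i : ℕ} (h : s.length ≤ i) : s.row i = [] := by
  simp [row, h]

theorem row_addEdge {s : PartialGraph} {u w : ℕ} (hu : u < s.length) (hw : w < s.length)
    (huw : u ≠ w) (i : ℕ) :
    (s.addEdge u w).row i =
      if i = w then u :: s.row i else if i = u then w :: s.row i else s.row i := by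
  simp only [row, addEdge, List.getD_eq_getElem?_getD, List.getElem?_modify]
  split_ifs <;> subst_vars <;> simp_all

theorem length_addEdge (s : PartialGraph) (u w : ℕ) : (s.addEdge u w).length = s.length := by
  simp [addEdge]

theorem row_addLeaf {s : PartialGraph} {u : ℕ} (hu : u < s.length) (i : ℕ) :
    (s.addLeaf u).row i =
      if i = s.length then [u] else if i = u then s.length :: s.row i else s.row i := by
  rcases lt_trichotomy i s.length with hi | rfl | hi
  · rw [if_neg hi.ne]
    simp only [row, addLeaf, List.getD_eq_getElem?_getD]
    rw [List.getElem?_append_left (by simpa using hi), List.getElem?_modify,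
      List.getElem?_eq_getElem hi]
    by_cases h : u = i
    · simp [h]
    · simp [h, Ne.symm h]
  · simp [row, addLeaf]
  · rw [if_neg hi.ne', if_neg (by omega), row_of_length_le hi.le, row_of_length_le]
    simpa [addLeaf] using hi

theorem length_addLeaf (s : PartialGraph) (u : ℕ) : (s.addLeaf u).length = s.length + 1 := by
  simp [addLeaf]

theorem map_zipIdx {α : Type*} (s : PartialGraph) (f : List ℕ × ℕ → α) :
    s.zipIdx.map f = (List.range s.length).map fun i => f (s.row i, i) := by
  apply List.ext_getElem
  · simp
  · intro i h₁ h₂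
    have : i < s.length := by simpa using h₁
    simp [row, this]

theorem mem_zipIdx {s : PartialGraph} {p : List ℕ × ℕ} :
    p ∈ s.zipIdx ↔ p.2 < s.length ∧ p.1 = s.row p.2 := by
  have := map_zipIdx s id
  rw [List.map_id] at this
  rw [this]
  simp only [List.mem_map, List.mem_range, id]
  constructor
  · rintro ⟨i, hi, rfl⟩
    exact ⟨hi, rfl⟩
  · rintro ⟨h₁, h₂⟩
    exact ⟨p.2, h₁, by rw [← h₂]⟩

/-- `φ` embeds the partial graph `s` into `G`. -/
structure Realizes (G : SimpleGraph V) (s : PartialGraph) (φ : ℕ → V) : Prop where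
  inj : ∀ i < s.length, ∀ j < s.length, φ i = φ j → i = j
  lt : ∀ i, ∀ j ∈ s.row i, j < s.length
  adj : ∀ i, ∀ j ∈ s.row i, G.Adj (φ i) (φ j)
  symm : ∀ i, ∀ j ∈ s.row i, i ∈ s.row j
  nodup : ∀ i, (s.row i).Nodup

theorem Realizes.addEdge {s : PartialGraph} {φ : ℕ → V} (h : s.Realizes G φ) {u w : ℕ}
    (hu : u < s.length) (hw : w < s.length) (huw : G.Adj (φ u) (φ w)) (hn : w ∉ s.row u) :
    (s.addEdge u w).Realizes G φ := by
  have hne : u ≠ w := by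
    rintro rfl
    exact G.loopless.irrefl _ huw
  have hn' : u ∉ s.row w := fun h' => hn (h.symm _ _ h')
  have hmem : ∀ i j, j ∈ (s.addEdge u w).row i ↔
      j ∈ s.row i ∨ (i = w ∧ j = u) ∨ (i = u ∧ j = w) := by
    intro i j
    rw [row_addEdge hu hw hne]
    split_ifs <;> simp <;> grind
  refine ⟨?_, ?_, ?_, ?_, ?_⟩
  · simpa only [length_addEdge] using h.inj
  · intro i j hj
    rw [length_addEdge]
    rcases (hmem i j).1 hj with h' | ⟨-, rfl⟩ | ⟨-, rfl⟩
    exacts [h.lt _ _ h', hu, hw]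
  · intro i j hj
    rcases (hmem i j).1 hj with h' | ⟨rfl, rfl⟩ | ⟨rfl, rfl⟩
    exacts [h.adj _ _ h', huw.symm, huw]
  · intro i j hj
    rw [hmem] at hj ⊢
    rcases hj with h' | h' | h'
    exacts [.inl (h.symm _ _ h'), .inr (.inr h'.symm), .inr (.inl h'.symm)]
  · intro i
    rw [row_addEdge hu hw hne]
    split_ifs with h₁ h₂
    · subst h₁; exact List.nodup_cons.2 ⟨hn', h.nodup _⟩
    · subst h₂; exact List.nodup_cons.2 ⟨hn, h.nodup _⟩
    · exact h.nodup _

theorem Realizes.addLeaf {s : PartialGraph} {φ : ℕ → V} (h : s.Realizes G φ) {u : ℕ} {v : V}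
    (hu : u < s.length) (huv : G.Adj (φ u) v) (hv : ∀ i < s.length, φ i ≠ v) :
    (s.addLeaf u).Realizes G (Function.update φ s.length v) := by
  have hmem : ∀ i j, j ∈ (s.addLeaf u).row i ↔
      j ∈ s.row i ∨ (i = s.length ∧ j = u) ∨ (i = u ∧ j = s.length) := by
    intro i j
    rw [row_addLeaf hu]
    have := @row_of_length_le s i
    split_ifs <;> simp <;> grind
  have hlt : ∀ i, ∀ j ∈ s.row i, i < s.length := fun i j hj => h.lt _ _ (h.symm _ _ hj)
  have hφ : ∀ i < s.length, Function.update φ s.length v i = φ i := fun i hi =>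
    Function.update_of_ne hi.ne _ _
  refine ⟨?_, ?_, ?_, ?_, ?_⟩
  · intro i hi j hj hij
    rw [length_addLeaf, Nat.lt_succ_iff_lt_or_eq] at hi hj
    rcases hi with hi | rfl <;> rcases hj with hj | rfl
    · rw [hφ i hi, hφ j hj] at hij
      exact h.inj i hi j hj hij
    · rw [hφ i hi, Function.update_self] at hij
      exact absurd hij (hv i hi)
    · rw [hφ j hj, Function.update_self] at hij
      exact absurd hij.symm (hv j hj)
    · rfl
  · intro i j hj
    rw [length_addLeaf]
    rcases (hmem i j).1 hj with h' | ⟨-, rfl⟩ | ⟨-, rfl⟩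
    exacts [(h.lt _ _ h').trans (Nat.lt_succ_self _), by omega, by omega]
  · intro i j hj
    rcases (hmem i j).1 hj with h' | ⟨rfl, rfl⟩ | ⟨rfl, rfl⟩
    · rw [hφ i (hlt _ _ h'), hφ j (h.lt _ _ h')]
      exact h.adj _ _ h'
    · rw [hφ _ hu, Function.update_self]
      exact huv.symm
    · rw [hφ _ hu, Function.update_self]
      exact huv
  · intro i j hj
    rw [hmem] at hj ⊢
    rcases hj with h' | h' | h'
    exacts [.inl (h.symm _ _ h'), .inr (.inr h'.symm), .inr (.inl h'.symm)]
  · intro i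
    rw [row_addLeaf hu]
    split_ifs with h₁ h₂
    · simp
    · exact List.nodup_cons.2 ⟨fun h' => (h.lt _ _ h').false, h.nodup _⟩
    · exact h.nodup _

theorem testBit_foldl_or (l : List ℕ) (a i : ℕ) :
    (l.foldl (fun a j => a ||| 1 <<< j) a).testBit i = true ↔ a.testBit i = true ∨ i ∈ l := by
  induction l generalizing a with
  | nil => simp
  | cons j l ih =>
    rw [List.foldl_cons, ih, Nat.testBit_or, Nat.one_shiftLeft, Nat.testBit_two_pow]
    simp only [Bool.or_eq_true, decide_eq_true_eq, List.mem_cons, eq_comm (a := i), or_assoc]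

theorem testBit_foldl_rows (l : List (List ℕ × ℕ)) (b a i : ℕ)
    (h : (l.foldl (fun a p => bif b.testBit p.2 then
      p.1.foldl (fun a j => a ||| 1 <<< j) a else a) a).testBit i = true) :
    a.testBit i = true ∨ ∃ p ∈ l, b.testBit p.2 = true ∧ i ∈ p.1 := by
  induction l generalizing a with
  | nil => exact .inl h
  | cons p l ih =>
    rw [List.foldl_cons] at h
    rcases ih _ h with h' | ⟨q, hq, h'⟩
    · cases hb : b.testBit p.2 with
      | false => rw [hb, cond_false] at h'; exact .inl h'
      | true =>
        rw [hb, cond_true, testBit_foldl_or] at h'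
        exact h'.imp id fun h' => ⟨p, List.mem_cons_self, hb, h'⟩
    · exact .inr ⟨q, List.mem_cons_of_mem _ hq, h'⟩

theorem Realizes.exists_walk_of_testBit_ball {s : PartialGraph} {φ : ℕ → V}
    (h : s.Realizes G φ) {u w : ℕ} (hu : u < s.length) (hw : w < s.length) (hn : w ∉ s.row u)
    {m i : ℕ} (hi : (s.ball u m).testBit i = true) :
    ∃ p : (G.deleteEdges {s(φ u, φ w)}).Walk (φ u) (φ i), p.length ≤ m := by
  induction m generalizing i with
  | zero =>
    rw [ball, Nat.one_shiftLeft, Nat.testBit_two_pow, decide_eq_true_eq] at hi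
    subst hi
    exact ⟨.nil, le_rfl⟩
  | succ m ih =>
    rcases testBit_foldl_rows _ _ _ _ hi with hi | ⟨⟨r, k⟩, hp, hk, hr⟩
    · obtain ⟨p, hp⟩ := ih hi
      exact ⟨p, hp.trans m.le_succ⟩
    · obtain ⟨hk', hrow⟩ : k < s.length ∧ r = s.row k := mem_zipIdx.1 hp
      subst hrow
      obtain ⟨p, hp⟩ := ih hk
      have hadj : (G.deleteEdges {s(φ u, φ w)}).Adj (φ k) (φ i) := by
        rw [SimpleGraph.deleteEdges_adj]
        refine ⟨h.adj _ _ hr, fun he => ?_⟩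
        have hi' := h.lt _ _ hr
        rcases Sym2.eq_iff.1 he with ⟨h₁, h₂⟩ | ⟨h₁, h₂⟩
        · rw [h.inj _ hk' _ hu h₁, h.inj _ hi' _ hw h₂] at hr
          exact hn hr
        · rw [h.inj _ hk' _ hw h₁, h.inj _ hi' _ hu h₂] at hr
          exact hn (h.symm _ _ hr)
      exact ⟨p.concat hadj, by rw [SimpleGraph.Walk.length_concat]; omega⟩

theorem Realizes.injOn_row {s : PartialGraph} {φ : ℕ → V} (h : s.Realizes G φ) (i : ℕ) :
    Set.InjOn φ ((s.row i).toFinset : Set ℕ) := fun a ha b hb hab =>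
  h.inj a (h.lt i a (by simpa using ha)) b (h.lt i b (by simpa using hb)) hab

theorem mem_row_cycle {n i j : ℕ} : j ∈ (cycle n).row i ↔ i < n ∧
    (j = (if i = 0 then n - 1 else i - 1) ∨ j = if i + 1 = n then 0 else i + 1) := by
  by_cases hi : i < n
  · simp [row, cycle, hi]
  · simp [row, cycle, hi]

theorem length_cycle (n : ℕ) : (cycle n).length = n := by simp [cycle]

theorem realizes_cycle {v : V} {c : G.Walk v v} (hc : c.IsCycle) :
    (cycle c.length).Realizes G c.getVert := by
  have h3 := hc.three_le_length
  have hadj : ∀ i < c.length, G.Adj (c.getVert i)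
      (c.getVert (if i + 1 = c.length then 0 else i + 1)) := by
    intro i hi
    have := c.adj_getVert_succ hi
    split_ifs with h
    · rw [h, c.getVert_length] at this
      rwa [c.getVert_zero]
    · exact this
  refine ⟨?_, ?_, ?_, ?_, ?_⟩
  · intro i hi j hj hij
    rw [length_cycle] at hi hj
    exact hc.getVert_injOn' (by simp; omega) (by simp; omega) hij
  · intro i j hj
    rw [mem_row_cycle] at hj
    rw [length_cycle]
    grind
  · intro i j hj
    rw [mem_row_cycle] at hj
    obtain ⟨hi, rfl | rfl⟩ := hj
    · split_ifs with h
      · subst h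
        have := hadj (c.length - 1) (by omega)
        rw [if_pos (by omega)] at this
        exact this.symm
      · have := hadj (i - 1) (by omega)
        rw [if_neg (by omega), Nat.sub_add_cancel (by omega)] at this
        exact this.symm
    · exact hadj i hi
  · intro i j hj
    rw [mem_row_cycle] at hj ⊢
    grind
  · intro i
    by_cases hi : i < c.length
    · simp [row, cycle, hi]
      grind
    · rw [row_of_length_le (by rw [length_cycle]; omega)]
      exact List.nodup_nil

theorem realizes_singleton (v : V) : PartialGraph.Realizes G [[]] fun _ => v := by
  have : ∀ i, row [[]] i = [] := fun i => by cases i <;> simp [row]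
  refine ⟨?_, ?_, ?_, ?_, ?_⟩ <;> simp [this]

end PartialGraph

theorem SimpleGraph.Adj.exists_isCycle_of_walk {u w : V} (h : G.Adj u w)
    (p : (G.deleteEdges {s(u, w)}).Walk u w) :
    ∃ c : G.Walk w w, c.IsCycle ∧ c.length ≤ p.length + 1 := by
  classical
  refine ⟨.cons h.symm (p.bypass.mapLe (G.deleteEdges_le _)), ?_, ?_⟩
  · rw [SimpleGraph.Walk.cons_isCycle_iff]
    refine ⟨p.bypass_isPath.mapLe _, fun he => ?_⟩
    rw [SimpleGraph.Walk.edges_mapLe_eq_edges] at he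
    have := SimpleGraph.Walk.edges_subset_edgeSet _ he
    simp [Sym2.eq_swap] at this
  · simpa using p.length_bypass_le_length

end

section

variable {V : Type*} [DecidableEq V] {G : SimpleGraph V}

namespace PartialGraph

/-- The known neighbours of `φ i`. -/
def neighbors (s : PartialGraph) (φ : ℕ → V) (i : ℕ) : Finset V := (s.row i).toFinset.image φ

theorem mem_neighbors {s : PartialGraph} {φ : ℕ → V} {i : ℕ} {v : V} :
    v ∈ s.neighbors φ i ↔ ∃ j ∈ s.row i, φ j = v := by
  simp [neighbors]

variable {s : PartialGraph} {φ : ℕ → V} {m u : ℕ}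

theorem Realizes.card_neighbors (h : s.Realizes G φ) (i : ℕ) :
    (s.neighbors φ i).card = (s.row i).length := by
  rw [neighbors, Finset.card_image_of_injOn (h.injOn_row i),
    List.toFinset_card_of_nodup (h.nodup i)]

/-- The test vector on `V` which takes the value `w i` at `φ i`. -/
noncomputable def testVector (s : PartialGraph) (φ : ℕ → V) (w : ℕ → ℤ) (v : V) : ℝ :=
  ∑ i ∈ Finset.range s.length, if φ i = v then (w i : ℝ) else 0

theorem Realizes.testVector_apply (h : s.Realizes G φ) (w : ℕ → ℤ) {i : ℕ} (hi : i < s.length) :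
    s.testVector φ w (φ i) = w i := by
  rw [testVector, Finset.sum_eq_single_of_mem i (Finset.mem_range.2 hi), if_pos rfl]
  intro j hj hji
  exact if_neg fun he => hji (h.inj j (Finset.mem_range.1 hj) i hi he)

theorem testVector_eq_zero (w : ℕ → ℤ) {v : V} (hv : ∀ i < s.length, φ i ≠ v) :
    s.testVector φ w v = 0 :=
  Finset.sum_eq_zero fun i hi => if_neg (hv i (Finset.mem_range.1 hi))

theorem Realizes.sum_neighbors (h : s.Realizes G φ) (w : ℕ → ℤ) (i : ℕ) :
    ∑ v ∈ s.neighbors φ i, s.testVector φ w v = ((s.row i).map w).sum := by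
  rw [neighbors, Finset.sum_image (h.injOn_row i), List.sum_toFinset _ (h.nodup i)]
  push_cast
  rw [List.map_map]
  congr 1
  exact List.map_congr_left fun j hj => h.testVector_apply w (h.lt i j hj)

variable [Fintype V] [DecidableRel G.Adj]

theorem Realizes.neighbors_subset (h : s.Realizes G φ) (i : ℕ) :
    s.neighbors φ i ⊆ G.neighborFinset (φ i) := by
  intro v hv
  obtain ⟨j, hj, rfl⟩ := mem_neighbors.1 hv
  simpa using h.adj i j hj

theorem Realizes.mem_row_of_adj (h : s.Realizes G φ) (hG : G.IsRegularOfDegree 3) {i j : ℕ}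
    (hi : 3 ≤ (s.row i).length) (hj : j < s.length) (hij : G.Adj (φ i) (φ j)) : j ∈ s.row i := by
  have := Finset.eq_of_subset_of_card_le (h.neighbors_subset i)
    (by rw [h.card_neighbors, SimpleGraph.card_neighborFinset_eq_degree, hG]; exact hi)
  have hmem : φ j ∈ s.neighbors φ i := by rw [this]; simpa using hij
  obtain ⟨k, hk, hkj⟩ := mem_neighbors.1 hmem
  rwa [← h.inj k (h.lt i k hk) j hj hkj]

theorem Realizes.exists_iterate_addLeaf (hG : G.IsRegularOfDegree 3) (n : ℕ)
    (h : s.Realizes G φ) (hu : u < s.length) (hn : (s.row u).length + n = 3)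
    (hadj : ∀ j < s.length, G.Adj (φ u) (φ j) → j ∈ s.row u) :
    ∃ ψ, ((PartialGraph.addLeaf u)^[n] s).Realizes G ψ := by
  induction n generalizing s φ with
  | zero => exact ⟨φ, h⟩
  | succ n ih =>
    obtain ⟨v, hv, hv'⟩ : ∃ v ∈ G.neighborFinset (φ u), v ∉ s.neighbors φ u := by
      apply Finset.exists_mem_notMem_of_card_lt_card
      rw [h.card_neighbors, SimpleGraph.card_neighborFinset_eq_degree, hG]
      omega
    rw [SimpleGraph.mem_neighborFinset] at hv
    have hne : ∀ i < s.length, φ i ≠ v := by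
      rintro i hi rfl
      exact hv' (mem_neighbors.2 ⟨i, hadj i hi hv, rfl⟩)
    rw [Function.iterate_succ_apply]
    have hrow : (s.addLeaf u).row u = s.length :: s.row u := by
      rw [row_addLeaf hu, if_neg hu.ne, if_pos rfl]
    refine ih (h.addLeaf hu hv hne) (by rw [length_addLeaf]; omega) ?_ ?_
    · rw [hrow, List.length_cons]
      omega
    · intro j hj hj'
      rw [hrow]
      rw [length_addLeaf, Nat.lt_succ_iff_lt_or_eq] at hj
      rcases hj with hj | rfl
      · rw [Function.update_of_ne hu.ne, Function.update_of_ne hj.ne] at hj'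
        exact List.mem_cons_of_mem _ (hadj j hj hj')
      · exact List.mem_cons_self

theorem Realizes.exists_extension (hG : G.IsRegularOfDegree 3)
    (hm : ∀ (v : V) (c : G.Walk v v), c.IsCycle → m + 1 < c.length)
    (h : s.Realizes G φ) (hu : u < s.length) (hn : (s.row u).length < 3) :
    ∃ t ∈ s.extensions m u, ∃ ψ, t.Realizes G ψ := by
  by_cases hex : ∃ j < s.length, G.Adj (φ u) (φ j) ∧ j ∉ s.row u
  · obtain ⟨j, hj, hadj, hjrow⟩ := hex
    have hdeg : (s.row j).length < 3 := by
      by_contra! hdeg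
      exact hjrow (h.symm _ _ (h.mem_row_of_adj hG hdeg hu hadj.symm))
    have hball : (s.ball u m).testBit j = false := by
      rw [Bool.eq_false_iff]
      intro hb
      obtain ⟨p, hp⟩ := h.exists_walk_of_testBit_ball hu hj hjrow hb
      obtain ⟨c, hc, hc'⟩ := hadj.exists_isCycle_of_walk p
      have := hm _ c hc
      omega
    refine ⟨s.addEdge u j, ?_, φ, h.addEdge hu hj hadj hjrow⟩
    refine List.mem_append_left _ (List.mem_map_of_mem (List.mem_map.2 ⟨(s.row j, j), ?_, rfl⟩))
    rw [List.mem_filter]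
    exact ⟨mem_zipIdx.2 ⟨hj, rfl⟩, by simp [hdeg, hball]⟩
  · push Not at hex
    exact ⟨_, List.mem_append_right _ List.mem_cons_self,
      h.exists_iterate_addLeaf hG _ hu (by omega) hex⟩

theorem sum_testVector_mul (w : ℕ → ℤ) (g : V → ℝ) :
    ∑ v, s.testVector φ w v * g v = ∑ i ∈ Finset.range s.length, w i * g (φ i) := by
  simp only [testVector, Finset.sum_mul, ite_mul, zero_mul]
  rw [Finset.sum_comm]
  simp

theorem Realizes.mul_sum_row_le (hG : G.IsRegularOfDegree 3) (h : s.Realizes G φ) {w : ℕ → ℤ}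
    (hw : ∀ i < s.length, 3 ≤ (s.row i).length ∨ 0 ≤ w i) {i : ℕ} (hi : i < s.length) :
    (w i : ℝ) * ((s.row i).map w).sum ≤
      w i * ∑ v ∈ G.neighborFinset (φ i), s.testVector φ w v := by
  rw [← h.sum_neighbors]
  by_cases hdeg : 3 ≤ (s.row i).length
  · rw [Finset.eq_of_subset_of_card_le (h.neighbors_subset i)
      (by rw [h.card_neighbors, SimpleGraph.card_neighborFinset_eq_degree, hG]; exact hdeg)]
  · refine mul_le_mul_of_nonneg_left ?_ (by exact_mod_cast (hw i hi).resolve_left hdeg)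
    refine Finset.sum_le_sum_of_subset_of_nonneg (h.neighbors_subset i) fun v hv hv' => ?_
    rw [SimpleGraph.mem_neighborFinset] at hv
    by_cases hex : ∃ j < s.length, φ j = v
    · obtain ⟨j, hj, rfl⟩ := hex
      rw [h.testVector_apply w hj]
      refine mod_cast (hw j hj).resolve_left fun hdeg' => hv' (mem_neighbors.2 ⟨j, ?_, rfl⟩)
      exact h.symm _ _ (h.mem_row_of_adj hG hdeg' hi hv.symm)
    · push Not at hex
      exact (testVector_eq_zero w hex).ge

theorem sum_weight (x : ℕ) (l : List ℕ) :
    Int.subNatNat (l.map (digit x)).sum (32 * l.length) = (l.map (weight x)).sum := by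
  induction l with
  | nil => rfl
  | cons j l ih =>
    rw [Int.subNatNat_eq_coe] at ih
    simp only [List.map_cons, List.sum_cons, List.length_cons, ← ih, weight, Int.subNatNat_eq_coe]
    push_cast
    ring

theorem sum_map_zipIdx (s : PartialGraph) (f : List ℕ × ℕ → ℤ) :
    (s.zipIdx.map f).sum = ∑ i ∈ Finset.range s.length, f (s.row i, i) := by
  rw [map_zipIdx, ← List.sum_toFinset _ List.nodup_range, List.toFinset_range]

theorem Realizes.violates_eq_false (hG : G.IsRegularOfDegree 3)
    (hQ : ∀ f : V → ℝ, 1000 * ∑ v, f v * ∑ w ∈ G.neighborFinset v, f w ≤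
      1900 * ∑ v, f v * f v + 55 * ((∑ v, f v) * ∑ v, f v))
    (h : s.Realizes G φ) (x : ℕ) : s.violates x = false := by
  rw [Bool.eq_false_iff]
  intro hx
  simp only [violates, Bool.and_eq_true, List.all_eq_true, Bool.or_eq_true, decide_eq_true_eq,
    sum_map_zipIdx, sum_weight] at hx
  obtain ⟨h₁, h₂⟩ := hx
  have hw : ∀ i < s.length, 3 ≤ (s.row i).length ∨ 0 ≤ weight x i := fun i hi =>
    h₁ (s.row i, i) (mem_zipIdx.2 ⟨hi, rfl⟩)
  have hf := hQ (s.testVector φ (weight x))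
  have hsum := sum_testVector_mul (s := s) (φ := φ) (weight x) fun _ => 1
  simp only [mul_one] at hsum
  rw [sum_testVector_mul, sum_testVector_mul, hsum] at hf
  have hsq : ∑ i ∈ Finset.range s.length, (weight x i : ℝ) * s.testVector φ (weight x) (φ i) =
      ∑ i ∈ Finset.range s.length, (weight x i : ℝ) * weight x i :=
    Finset.sum_congr rfl fun i hi => by rw [h.testVector_apply _ (Finset.mem_range.1 hi)]
  rw [hsq] at hf
  have hle : ∑ i ∈ Finset.range s.length, (weight x i : ℝ) * ((s.row i).map (weight x)).sum ≤ _ :=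
    Finset.sum_le_sum fun i hi => h.mul_sum_row_le hG hw (Finset.mem_range.1 hi)
  have h₂' := (Int.cast_lt (R := ℝ)).2 h₂
  push_cast at h₂' hle
  linarith

theorem Realizes.false_of_refute (hG : G.IsRegularOfDegree 3)
    (hQ : ∀ f : V → ℝ, 1000 * ∑ v, f v * ∑ w ∈ G.neighborFinset v, f w ≤
      1900 * ∑ v, f v * f v + 55 * ((∑ v, f v) * ∑ v, f v))
    (hm : ∀ (v : V) (c : G.Walk v v), c.IsCycle → m + 1 < c.length) {ts : List ℕ}
    {stack : List PartialGraph} (hr : refute m ts stack = true) (hs : s ∈ stack)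
    (h : s.Realizes G φ) : False := by
  induction ts generalizing stack s φ with
  | nil =>
    cases stack with
    | nil => simp at hs
    | cons => simp [refute] at hr
  | cons t ts ih =>
    cases stack with
    | nil => simp at hs
    | cons s' stack =>
      rw [refute] at hr
      split_ifs at hr
      · rw [Bool.and_eq_true] at hr
        rcases List.mem_cons.1 hs with rfl | hs
        · rw [h.violates_eq_false hG hQ] at hr
          exact Bool.false_ne_true hr.1
        · exact ih hr.2 hs h
      · simp only [Bool.and_eq_true, decide_eq_true_eq] at hr
        obtain ⟨hu, hdeg, hr⟩ := hr
        rcases List.mem_cons.1 hs with rfl | hs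
        · obtain ⟨t', ht', ψ, hψ⟩ := h.exists_extension hG hm hu hdeg
          exact ih hr (List.mem_append_left _ ht') hψ
        · exact ih hr (List.mem_append_right _ hs) h

theorem lt_length_of_refute (hG : G.IsRegularOfDegree 3)
    (hQ : ∀ f : V → ℝ, 1000 * ∑ v, f v * ∑ w ∈ G.neighborFinset v, f w ≤
      1900 * ∑ v, f v * f v + 55 * ((∑ v, f v) * ∑ v, f v))
    (hm : ∀ (v : V) (c : G.Walk v v), c.IsCycle → m + 1 < c.length) {ts : List ℕ}
    (hr : refute m ts [cycle (m + 2)] = true) (v : V) (c : G.Walk v v) (hc : c.IsCycle) :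
    m + 2 < c.length := by
  refine (Nat.succ_le_of_lt (hm v c hc)).lt_of_ne fun he => ?_
  exact Realizes.false_of_refute hG hQ hm hr List.mem_cons_self
    (by have := realizes_cycle hc; rwa [← he] at this)

end PartialGraph

end

namespace PartialGraph

/-- Refutation of a cycle of length three when there are no shorter cycles. -/
def threeCycleCert : List ℕ := [
  0, 17584453]

/-- Refutation of a cycle of length four when there are no shorter cycles. -/
def fourCycleCert : List ℕ := [
  0, 2, 71992365381]

/-- Refutation of a cycle of length five when there are no shorter cycles. -/
def fiveCycleCert : List ℕ := [
  0, 2, 4, 312750076400849]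

/-- Refutation of a cycle of length six when there are no shorter cycles. -/
def sixCycleCert : List ℕ := [
  0, 2, 4, 6, 8, 10, 12, 4947277106230830330311, 14, 19649994115666825768104391, 16,
  80485752692934048428534297031, 16, 80485761987751180973606981957, 24,
  5309545120733260296527799947721, 5312137057535986568651789333063, 5317011446440672753484204634695,
  26, 18, 329669721015265884046417839575883, 329674595404170570231250254877515, 26,
  21098857155768484004912797420139341, 21098862030157388691097629835440973,
  1350326865426933013290499916213872535, 26, 329669761533474534239496030180567,
  329677073116831563516744653133015, 20, 21098857155759345876446887938413523,
  21098862030148250562631720353715155, 21099173989828924863762507261833543, 18,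
  1350326863030917585732657966019809849, 1350326870342500942761935214642762297, 18,
  1350367734708233360988950605664179275, 1350367742019816718018227854287131723,
  1356259457677915852686539277535139165, 89079374587233250661645194252245994921,
  1815686458819707137657251126609881405, 5703738428770148733858317839710632537915, 26,
  329669721629173490790812103258957, 329669761533474534239496030180567, 28,
  21098862262271146093742298437596627, 20, 21099491057240530827523374782436691,
  21788461792742121034759060923397333, 1350409249761967655692399146547089733,
  21747896777027984919289864929939783, 21758513390113579797726926288998855,
  1350326852742373600891355208171163843, 26, 329674596018078176975644518560589,
  329677073116831563516744653133015, 30, 21098872011048955466111963268199891, 20,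
  21099500806018340199893039613039955, 21788478853103287436405974376953045,
  1350409225390023132261474984470581573, 21747901651416889605474697345241415,
  21758520701696936827004174911951303, 1350326845430790243862077959548211395,
  1772211113829443728046986312438293147, 16, 80486357005928022548903907653, 26,
  5309546905787790821253690724809, 5312138842590517093377680110151, 5317013231495203278210095411783,
  24, 18, 329669720420247707204842542650187, 329674594809152393389674957951819, 24,
  21098857155173465828071222123213645, 21098862029562370514256054538515277,
  1350326865426337995113658340916946839, 24, 329669760343438180556345436329175,
  329677071926795209833594059281623, 20, 21098857154569309522763737344562131,
  21098862028958214208948569759863763, 21099173989828924863762507261833543, 18,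
  1350326863032702640263182691910586937, 1350326870344285997292459940533539385, 18,
  1350367734712398488226841632742659147, 1350367742023981845256118881365611595,
  1356259457677915852686539277535139165, 89079374587234440697998877402839846313,
  1815686458804831683236211744186739005, 5703738428770148733858317839710632537915, 24,
  329669721034155313949236806333261, 329669760343438180556345436329175, 28,
  21098862261676127916900723140670931, 20, 21099491058430567181206525376288083,
  21788461792147102857917485626471637, 1350409249772677982875547501891752261,
  21747896775837948565606714336088391, 21758513389518561620885350992073159,
  1350326852743563637245038358765015235, 24, 329674595423060000134069221634893,
  329677071926795209833594059281623, 30, 21098872010453937289270387971274195, 20,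
  21099500807208376553576190206891347, 21788478852508269259564399080027349,
  1350409225400733459444623339815244101, 21747901650226853251791546751390023,
  21758520701101918650162599615025607, 1350326845431980280215761110142062787,
  1772211113819328419040679532390556315, 18, 18, 24, 329986670556449941603117857821385,
  349952167510044554676690933306057, 28, 21098857192017664273627177723646407,
  21109476280359985347085718687355331, 21129441777313579960159291762840003,
  1350378350702169782846149779019916699, 24, 329993982139806970880366480773833,
  349959479093401583953939556258505, 30, 21098864503601021302904426346598855,
  21109483591943342376362967310307779, 21129449088896936989436540385792451,
  1350378321455836354729040784528106907, 36, 22, 23695005582609491573307240679265103,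
  23695010456998396259492073094566735, 23046285310571295148347661955674699,
  23066250807524889761421235031159371, 36, 24, 1360062439568822314804341931537472235,
  1343228021878902600261433996682161837, 1343188090884995411035286850531192493,
  86419630811017836825655833101388230717, 24, 1360062434694433410118157099122170603,
  1343228009692930338545971915643907757, 1343188078699023149319824769492938413,
  86419630808580642373312740685180579901, 1439894607495941368394263689099023057,
  1439934538489848557620410835249992401, 110736444771614159530726527857386539843, 36, 22,
  23695322456573774829590903646892619, 23715287953527369442664476722377291, 24,
  1360062439568822314804341931537472235, 1343228021878902600261433996682161837,
  1343188090884995411035286850531192493, 86419630811017836825655833101388230717, 32,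
  23056743466689176861388642633666621, 28, 25653208963359044855453811072094659, 26,
  20449503135792135567640666575737291, 24375102763266499782360724664496319,
  1350337310899134457740744494145638593, 1346431837781816522978648485867024717, 26,
  10711574550699993019993828300250109, 24355142102016183627803852560675007,
  1445139987499608412639046691761491893, 1346431681956105225764100547199382357, 34,
  23086691712119568780999002246893629, 28, 25703122705743031388137743760806339, 26,
  20429537638838540954567093500252619, 24385085511743297088897511202238655,
  1350347293647611255047281280683380929, 1346381924039432536445964553178313037, 26,
  10541867826594438808868457158630397, 24405055844400170160487785249386687,
  1445279745978283574930561703289884597, 1346371785465244441924879827972928341, 38, 38,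
  1476889088827557341108462996534054589, 1561264388146505009754369193044340281,
  1561294336391935401673979552657567289, 89163749398655191107689309389438832445, 38,
  1518427463696440717851984981912686271, 1603462099821913105447557507503058097,
  1603492048067343497367167867116285105, 91864392802200618473246280283529121337,
  1561912949925969137998920801627352247, 1561274529389992454863119585536871731,
  1561294494886946049476193158612356403, 5530854414494159707546833534008736649931, 36, 22,
  23695324893768227172683319854543435, 23715290390721821785756892930028107, 24,
  1360062434694433410118157099122170603, 1343228009692930338545971915643907757,
  1343188078699023149319824769492938413, 86419630808580642373312740685180579901, 32,
  23056745903883629204481058841317437, 30, 25653221149331306570915892110348739, 26,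
  20449508010181040253825498991038923, 24375114949238761497822805702750399,
  1350337306024745553054559661730336961, 1346431828033038713606278821036421453, 26,
  10711569676311088333808995884948477, 24355142102016183627803852560675007,
  1445140004559969579040693605215047605, 1346431679518910773421008130991731541, 34,
  23086694149314021124091418454544445, 30, 25703134891715293103599824799060419, 26,
  20429542513227445640751925915554251, 24385097697715558804359592240492735,
  1350347288773222350361096448268079297, 1346381914290654727073594888347709773, 26,
  10541862952205534122683624743328765, 24405055844400170160487785249386687,
  1445279763038644741332208616743440309, 1346371783028049989581787411765277525, 38, 38,
  1476889091264751793451555412741705405, 1561264390583699462097461609251991097,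
  1561294338829129854017071968865218105, 89163749401092385560032401805646483261, 38,
  1518427466133635170195077398120337087, 1603462104696302010133742339918359729,
  1603492052941732402053352699531586737, 91864392804637812925589372699736772153,
  1561912954800358042685105634042653879, 1561274534264381359549304417952173363,
  1561294499761334954162377991027658035, 5530854414494159707546833534008736649931, 36,
  31484401531057955294429800988833505, 32, 23056743466689176861388642633666621, 28,
  25653208963359044855453811072094659, 26, 20449503135792135567640666575737291,
  24375102763266499782360724664496319, 1350337310899134457740744494145638593,
  1346431837781816522978648485867024717, 26, 10711574550699993019993828300250109,
  24355142102016183627803852560675007, 1445139987499608412639046691761491893,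
  1346431681956105225764100547199382357, 32, 23056745903883629204481058841317437, 30,
  25653221149331306570915892110348739, 26, 20449508010181040253825498991038923,
  24375114949238761497822805702750399, 1350337306024745553054559661730336961,
  1346431828033038713606278821036421453, 26, 10711569676311088333808995884948477,
  24355142102016183627803852560675007, 1445140004559969579040693605215047605,
  1346431679518910773421008130991731541, 1478197938032388988917688213237394869, 36,
  31544298021918739133650520215287521, 34, 23086691712119568780999002246893629, 28,
  25703122705743031388137743760806339, 26, 20429537638838540954567093500252619,
  24385085511743297088897511202238655, 1350347293647611255047281280683380929,
  1346381924039432536445964553178313037, 26, 10541867826594438808868457158630397,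
  24405055844400170160487785249386687, 1445279745978283574930561703289884597,
  1346371785465244441924879827972928341, 34, 23086694149314021124091418454544445, 30,
  25703134891715293103599824799060419, 26, 20429542513227445640751925915554251,
  24385097697715558804359592240492735, 1350347288773222350361096448268079297,
  1346381914290654727073594888347709773, 26, 10541862952205534122683624743328765,
  24405055844400170160487785249386687, 1445279763038644741332208616743440309,
  1346371783028049989581787411765277525, 1478227886277819380837298572850621877,
  89122211023748226858127554273819217595, 18, 26, 329986672936522648969419045524169,
  349952169890117262042992121008841, 28, 21098857192612682450468753020572103,
  21109476280955003523927293984281027, 21129441777908598137000867059765699,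
  1350378350695624582900892450753734043, 26, 329993984519879678246667668476617,
  349959481473474291320240743961289, 30, 21098864504196039479746001643524551,
  21109483592538360553204542607233475, 21129449089491955166278115682718147,
  1350378321449291154783783456261924251, 36, 22, 23695005583799527926990391273116495,
  23695010458188432613175223688418127, 23046285311761331502030812549526091,
  23066250808714926115104385625010763, 36, 26, 1360062439579532641987490286882134763,
  1343228021873547436669859819009830573, 1343188090879640247443712672858861229,
  86419630811016646789302149950794379325, 26, 1360062434705143737301305454466833131,
  1343228009687575174954397737971576493, 1343188078693667985728250591820607149,
  86419630808579452336959057534586728509, 1439894607498916459278471565583651537,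
  1439934538492823648504618711734620881, 110736444771618919676141260459761945411, 36, 22,
  23695322457763811183274054240744011, 23715287954717405796347627316228683, 26,
  1360062439579532641987490286882134763, 1343228021873547436669859819009830573,
  1343188090879640247443712672858861229, 86419630811016646789302149950794379325, 32,
  23056743466689176861388642633666621, 28, 25653208963954063032295386369020355, 24,
  20449503134602099213957515981885899, 24375102760886427074994423476793535,
  1350337310900919512271269220036415681, 1346431837781221504801806910570099021, 24,
  10711574553080065727360129487952893, 24355142099636110920437551372972223,
  1445139987497823358108521965870714805, 1346431681954915189410417396605530965, 34,
  23086691712119568780999002246893629, 28, 25703122706338049564979319057732035, 24,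
  20429537637648504600883942906401227, 24385085509363224381531210014535871,
  1350347293649396309577806006574158017, 1346381924038837518269122977881387341, 24,
  10541867828974511516234758346333181, 24405055842020097453121484061683903,
  1445279745976498520400036977399107509, 1346371785464054405571196677379076949, 38, 38,
  1476889088826962322931621421237128893, 1561264388146505009754369193044340281,
  1561294336391935401673979552657567289, 89163749398655191107689309389438832445, 38,
  1518427463695250681498301831318834879, 1603462099821913105447557507503058097,
  1603492048067343497367167867116285105, 91864392802200618473246280283529121337,
  1561912949924779101645237651033500855, 1561274529389992454863119585536871731,
  1561294494886946049476193158612356403, 5530854414494159707546833534008736649931, 36, 22,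
  23695324894958263526366470448394827, 23715290391911858139440043523879499, 26,
  1360062434705143737301305454466833131, 1343228009687575174954397737971576493,
  1343188078693667985728250591820607149, 86419630808579452336959057534586728509, 32,
  23056745903883629204481058841317437, 30, 25653221149926324747757467407274435, 24,
  20449508008991003900142348397187531, 24375114946858688790456504515047615,
  1350337306026530607585084387621114049, 1346431828032443695429437245739495757, 24,
  10711569678691161041175297072651261, 24355142099636110920437551372972223,
  1445140004558184524510168879324270517, 1346431679517720737067324980397880149, 34,
  23086694149314021124091418454544445, 30, 25703134892310311280441400095986115, 24,
  20429542512037409287068775321702859, 24385097695335486096993291052789951,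
  1350347288775007404891621174158856385, 1346381914290059708896753313050784077, 24,
  10541862954585606830049925931031549, 24405055842020097453121484061683903,
  1445279763036859686801683890852663221, 1346371783026859953228104261171426133, 38, 38,
  1476889091264156775274713837444779709, 1561264390583699462097461609251991097,
  1561294338829129854017071968865218105, 89163749401092385560032401805646483261, 38,
  1518427466132445133841394247526485695, 1603462104696302010133742339918359729,
  1603492052941732402053352699531586737, 91864392804637812925589372699736772153,
  1561912954799168006331422483448802487, 1561274534264381359549304417952173363,
  1561294499761334954162377991027658035, 5530854414494159707546833534008736649931, 36,
  31484401536413118886003978661164769, 32, 23056743466689176861388642633666621, 28,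
  25653208963954063032295386369020355, 24, 20449503134602099213957515981885899,
  24375102760886427074994423476793535, 1350337310900919512271269220036415681,
  1346431837781221504801806910570099021, 24, 10711574553080065727360129487952893,
  24355142099636110920437551372972223, 1445139987497823358108521965870714805,
  1346431681954915189410417396605530965, 32, 23056745903883629204481058841317437, 30,
  25653221149926324747757467407274435, 24, 20449508008991003900142348397187531,
  24375114946858688790456504515047615, 1350337306026530607585084387621114049,
  1346431828032443695429437245739495757, 24, 10711569678691161041175297072651261,
  24355142099636110920437551372972223, 1445140004558184524510168879324270517,
  1346431679517720737067324980397880149, 1478197938032388988917688213237394869, 36,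
  31544298027273902725224697887618785, 34, 23086691712119568780999002246893629, 28,
  25703122706338049564979319057732035, 24, 20429537637648504600883942906401227,
  24385085509363224381531210014535871, 1350347293649396309577806006574158017,
  1346381924038837518269122977881387341, 24, 10541867828974511516234758346333181,
  24405055842020097453121484061683903, 1445279745976498520400036977399107509,
  1346371785464054405571196677379076949, 34, 23086694149314021124091418454544445, 30,
  25703134892310311280441400095986115, 24, 20429542512037409287068775321702859,
  24385097695335486096993291052789951, 1350347288775007404891621174158856385,
  1346381914290059708896753313050784077, 24, 10541862954585606830049925931031549,
  24405055842020097453121484061683903, 1445279763036859686801683890852663221,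
  1346371783026859953228104261171426133, 1478227886277819380837298572850621877,
  89122211023748226858127554273819217595, 28, 329672233749137477667350032708167, 18, 24,
  21098857192036263167310833685123527, 21748216357210346958191836945249485,
  21768181854163941571265410020734157, 36, 22, 1351624932143327548800058143545258567,
  1352274439551774417613500830218768969, 1352304387797204809533111189831995977,
  1559316801534216793784380529929596999, 86919379086897765902321019418117237563,
  1896816105510326843224885855810367441, 1353613712294829586579581294147309105,
  1353643660540259978499191653760536113, 5531103644743410548566363922761806188229, 18, 26,
  21098857193821317697835559575900615, 21748216360185437842399713429877965,
  21768181857139032455473286505362637, 36, 22, 1351624932143922566976899718842184263,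
  1352274439550584381259817679624917577, 1352304387796014773179428039238144585,
  1559316801536596866491746831117299783, 86919379086904906120443118321680345915,
  1896816105518062079523826334670401489, 1353613712291854495695373417662680625,
  1353643660537284887614983777275907633, 5531103644743412333620894447487696965317,
  340288846211230099997856641094083, 360254343164824713071429716578755, 18, 24,
  21099174104695760455725103174701769, 21119139601649355068798676250186441,
  1350378350702169782846149779019916699, 26, 21099174107075833163091404362404553,
  21119139604029427776164977437889225, 1350378350695624582900892450753734043,
  1350326852364093000892620019706930877, 30, 329677108138042163852182448009799, 18, 24,
  21098864503619620196588082308075975, 21748230980377061016746334191154381,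
  21768196477330655629819907266639053, 36, 22, 1351624934580522001143150559752909383,
  1352274439551774417613500830218768969, 1352304387797204809533111189831995977,
  1559316808845800150813657778552549447, 86919379108832515973408851163986094907,
  1896816151817021437743641763755732945, 1353613704983246229550304045524356657,
  1353643653228676621469914405137583665, 5531103644745847743018707015178013839045, 18, 26,
  21098864505404674727112808198853063, 21748230983352151900954210675782861,
  21768196480305746514027783751267533, 36, 22, 1351624934581117019319992135049835079,
  1352274439550584381259817679624917577, 1352304387796014773179428039238144585,
  1559316808848180223521024079740252231, 86919379108839656191530950067549203259,
  1896816151824756674042582242615766993, 1353613704980271138666096169039728177,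
  1353643653225701530585706528652955185, 5531103644745849528073237539903904616133,
  340296157794587129275105264046531, 360261654748181742348678339531203, 18, 24,
  21099181416279117485002351797654217, 21119146913232712098075924873138889,
  1350378321455836354729040784528106907, 26, 21099181418659190192368652985357001,
  21119146915612784805442226060841673, 1350378321449291154783783456261924251,
  1350326820680565120432418609007470269, 24, 24, 1350326860718431559972264769102762843,
  1350326880215987178717004098763969371, 20, 28, 1350450135092787812515435861386902241,
  1516531058009715969169455352473430819, 1352973706965868898870744718102997795,
  86463116136198489935899934804801228603, 30, 1350450178962287954691099353124616929,
  1516531036074965898081623606604573475, 1352973685031118827782912972234140451,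
  86463116131324101031213749972385926971, 32, 89079375208491266782755813250495680713,
  86716229516186597026704211561766161319, 86716229516186597026704211561766161319,
  86420917649959388629228908867353284919, 86420917649959388629228908867353284919,
  5530938788384974804043222627775644668215, 20, 28, 1350430169595834217902362288311417569,
  1516481144267331982636771419784719139, 1352923793223484912338060785414286115,
  86463106153450013138593398018263486267, 30, 1350430213465334360078025780049132257,
  1516481122332581911548939673915861795, 1352923771288734841250229039545428771,
  86463106148575624233907213185848184635, 34, 89079415139485173971981960396646650057,
  86716169619695736242864990842539707303, 86716169619695736242864990842539707303,
  86420857753468527845389688148126830903, 86420857753468527845389688148126830903,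
  5530938728488483943259383407056418214199, 20, 1352923001484866307106857701762970713,
  1352923013670838568822319782801224793, 1352274598008174577424945779135271501,
  1352314529002081766651092925286240845, 94399531743342865980502331741167677517, 20,
  1516480352528713377405568336133403737, 1516480364714685639121030417171657817,
  1474942611291059880148978754913096269, 1474982542284967069375125901064065613,
  94603978432147674818375720034130718797, 113005478498799410429617858803208907203, 24,
  1350326860718431559972264769102762843, 1350327172366700637496008250313396421,
  1350347137863654232109081823388881093, 1352273971961764001789169572606308555,
  1474941985244649304513202548384133323, 89079374574704623508723545020621377603, 24,
  1350326880215987178717004098763969371, 1350327177241089542182193082728698053,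
  1350347142738043136795266655804182725, 1352273986584930715847724069852213451,
  1474941999867816018571757045630038219, 89079374577141817961066637436829028419, 24, 20, 28,
  1350450135092787812515435861386902241, 1516531058009715969169455352473430819,
  1352973706965868898870744718102997795, 86463116136198489935899934804801228603, 30,
  1350450178962287954691099353124616929, 1516531036074965898081623606604573475,
  1352973685031118827782912972234140451, 86463116131324101031213749972385926971, 32,
  89079375208491266782755813250495680713, 86716229516186597026704211561766161319,
  86716229516186597026704211561766161319, 86420917649959388629228908867353284919,
  86420917649959388629228908867353284919, 5530938788384974804043222627775644668215,
  1350327172366700637496008250313396421, 1350327177241089542182193082728698053, 36, 22,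
  1354221075659540211257823891396268883, 1354221085408318020630193556226872147,
  1397098406319586134340573213549171017, 94484555604400109053501323712504524743, 28, 20,
  1352923001525298902220038016583086539, 1351006313698636692711831625760805315,
  86420280162408437588093695724302347967, 22, 1349130193556943402646306092123889139,
  86461838819646405690742524238456688181, 1354272418100803968421778184900726843,
  86418971471696142381827294126093406665, 30, 20, 1352923016148465616278592513828991435,
  1351006321010220049741108874383757763, 86420280152659659778721326059471744703, 22,
  1349130215491693473734137837992746483, 86461838807460433429027062157418434101,
  1354272432723970682480332682146631739, 86418971466821753477141109293678105033,
  91781316210881719375419361510421147195, 38, 22, 1599557102225310816705889842951918419,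
  1599557111974088626078259507782521683, 1683323770646318507363316823697428809,
  94729891630965879658949389664060174279, 28, 20, 1516480352569145972518748650953519563,
  1391895651459598460286509284353413571, 86379390824647475820519018065709739711, 22,
  1267351518035019867496950774938672627, 86380060144124482155593168921271471669,
  1599608444666574573869844136456376379, 86296303458413257079103261150315581897, 30, 20,
  1516480367192312686577303148199424459, 1391895658771181817315786532976366019,
  86379390814898698011146648400879136447, 22, 1267351539969769938584782520807529971,
  86380060131938509893877706840233217589, 1599608459289741287928398633702281275,
  86296303453538868174417076317900280265, 91863094886403642910568716827606363707,
  91737830883149043037700533918805749439, 24, 20, 28, 1350430169595834217902362288311417569,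
  1516481144267331982636771419784719139, 1352923793223484912338060785414286115,
  86463106153450013138593398018263486267, 30, 1350430213465334360078025780049132257,
  1516481122332581911548939673915861795, 1352923771288734841250229039545428771,
  86463106148575624233907213185848184635, 34, 89079415139485173971981960396646650057,
  86716169619695736242864990842539707303, 86716169619695736242864990842539707303,
  86420857753468527845389688148126830903, 86420857753468527845389688148126830903,
  5530938728488483943259383407056418214199, 1350347137863654232109081823388881093,
  1350347142738043136795266655804182725, 36, 22, 1354221075659540211257823891396268883,
  1354221085408318020630193556226872147, 1397078440822632539727499640473686345,
  94484555604400109053501323712504524743, 28, 20, 1352923001525298902220038016583086539,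
  1350976365453206300792221266147578307, 86420300127905391182706769297377832639, 22,
  1349030366072175429580938226746465779, 86461838819646405690742524238456688181,
  1354262435352327171115241398362984507, 86418971471696142381827294126093406665, 30, 20,
  1352923016148465616278592513828991435, 1350976372764789657821498514770530755,
  86420300118156613373334399632547229375, 22, 1349030388006925500668769972615323123,
  86461838807460433429027062157418434101, 1354262449975493885173795895608889403,
  86418971466821753477141109293678105033, 91781326193630196172725898296958889531, 38, 22,
  1599557102225310816705889842951918419, 1599557111974088626078259507782521683,
  1683303805149364912750243250621944137, 94729891630965879658949389664060174279, 28, 20,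
  1516480352569145972518748650953519563, 1391865703214168068366898924740186563,
  86379410790144429415132091638785224383, 22, 1267251690550251894431582909561249267,
  86380060144124482155593168921271471669, 1599598461918097776563307349918634043,
  86296303458413257079103261150315581897, 30, 20, 1516480367192312686577303148199424459,
  1391865710525751425396176173363139011, 86379410780395651605759721973954621119, 22,
  1267251712485001965519414655430106611, 86380060131938509893877706840233217589,
  1599598476541264490621861847164538939, 86296303453538868174417076317900280265,
  91863104869152119707875253614144106043, 91737850848645996632313607491881234111, 24, 20,
  1352923001484866307106857701762970713, 1352923013670838568822319782801224793,
  1352274598008174577424945779135271501, 1352314529002081766651092925286240845,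
  94399531743342865980502331741167677517, 1352273971961764001789169572606308555,
  1352273986584930715847724069852213451, 36, 22, 1354221075659540211257823891396268883,
  1354221085408318020630193556226872147, 1397098406319586134340573213549171017,
  94484555604400109053501323712504524743, 28, 20, 1352923001525298902220038016583086539,
  1351006313698636692711831625760805315, 86420280162408437588093695724302347967, 22,
  1349130193556943402646306092123889139, 86461838819646405690742524238456688181,
  1354272418100803968421778184900726843, 86418971471696142381827294126093406665, 30, 20,
  1352923016148465616278592513828991435, 1351006321010220049741108874383757763,
  86420280152659659778721326059471744703, 22, 1349130215491693473734137837992746483,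
  86461838807460433429027062157418434101, 1354272432723970682480332682146631739,
  86418971466821753477141109293678105033, 91781316210881719375419361510421147195, 36, 22,
  1354221075659540211257823891396268883, 1354221085408318020630193556226872147,
  1397078440822632539727499640473686345, 94484555604400109053501323712504524743, 28, 20,
  1352923001525298902220038016583086539, 1350976365453206300792221266147578307,
  86420300127905391182706769297377832639, 22, 1349030366072175429580938226746465779,
  86461838819646405690742524238456688181, 1354262435352327171115241398362984507,
  86418971471696142381827294126093406665, 30, 20, 1352923016148465616278592513828991435,
  1350976372764789657821498514770530755, 86420300118156613373334399632547229375, 22,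
  1349030388006925500668769972615323123, 86461838807460433429027062157418434101,
  1354262449975493885173795895608889403, 86418971466821753477141109293678105033,
  91781326193630196172725898296958889531, 91738479603343095926489442514602004159, 24, 20,
  1516480352528713377405568336133403737, 1516480364714685639121030417171657817,
  1474942611291059880148978754913096269, 1474982542284967069375125901064065613,
  94603978432147674818375720034130718797, 1474941985244649304513202548384133323,
  1474941999867816018571757045630038219, 38, 22, 1599557102225310816705889842951918419,
  1599557111974088626078259507782521683, 1683323770646318507363316823697428809,
  94729891630965879658949389664060174279, 28, 20, 1516480352569145972518748650953519563,
  1391895651459598460286509284353413571, 86379390824647475820519018065709739711, 22,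
  1267351518035019867496950774938672627, 86380060144124482155593168921271471669,
  1599608444666574573869844136456376379, 86296303458413257079103261150315581897, 30, 20,
  1516480367192312686577303148199424459, 1391895658771181817315786532976366019,
  86379390814898698011146648400879136447, 22, 1267351539969769938584782520807529971,
  86380060131938509893877706840233217589, 1599608459289741287928398633702281275,
  86296303453538868174417076317900280265, 91863094886403642910568716827606363707, 38, 22,
  1599557102225310816705889842951918419, 1599557111974088626078259507782521683,
  1683303805149364912750243250621944137, 94729891630965879658949389664060174279, 28, 20,
  1516480352569145972518748650953519563, 1391865703214168068366898924740186563,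
  86379410790144429415132091638785224383, 22, 1267251690550251894431582909561249267,
  86380060144124482155593168921271471669, 1599598461918097776563307349918634043,
  86296303458413257079103261150315581897, 30, 20, 1516480367192312686577303148199424459,
  1391865710525751425396176173363139011, 86379410780395651605759721973954621119, 22,
  1267251712485001965519414655430106611, 86380060131938509893877706840233217589,
  1599598476541264490621861847164538939, 86296303453538868174417076317900280265,
  91863104869152119707875253614144106043, 91779368941104057694064120173194612415,
  5876538068222189657950404765492573876033]

/-- Refutation of a cycle of length seven when there are no shorter cycles. -/
def sevenCycleCert : List ℕ := [
  0, 2, 4, 6, 8, 10, 12, 14, 16, 18, 32, 32, 22, 34, 34, 24, 28, 20,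
  5531104902104405391319247673853334024389, 6211506169855830080922612694744521535675,
  24070299927417486886079132575733536362606395, 354150308743646006139243289605233875111997, 28, 20,
  5530941344753361544248948963218963591365, 6211669727206873927992911405378891968699,
  24070299927417486886079132575733536362606395, 354150349632983767101010864282892467720253,
  353980209047854497177363690448983325184191, 28, 387160271808147736582780909993051831398589,
  387160271808147736582780909993051831398589, 22676843719301773737348658303060275679735997, 34, 34,
  24, 30, 20, 5531104902106842585771590766269541675205, 6211506169846081303113240325079690932411,
  24070299927417484448884680232641120154955579, 354150308743638694555886260327985252159549, 30, 20,
  5530941344755798738701292055635171242181, 6211669727197125150183539035714061365435,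
  24070299927417484448884680232641120154955579, 354150349632976455517653835005643844767805,
  353980209047854497177363690448983325184191, 30, 387160271808140424999423880715803208446141,
  387160271808140424999423880715803208446141, 22676843719301763988570848930690610849132733, 26, 26,
  36, 354490504769141657708619055748190687194809, 397536228077291033463119070963118274474069, 26,
  38, 354490422990466135785083906392873501978297, 397536391634642077310189369673752644907093, 40,
  5520304964255210123506349051726769942993, 5520304964255210123506349051726769942993,
  353969448691296196710001947061857418473937, 24778087250633167914209917954205593261805383, 32, 20,
  20, 28, 40, 24, 354995612703886403358175469840054586429385,
  354995612703886403358175469840054586429385, 22654720090696601200805451212732499833958721, 28, 40,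
  24, 354687445992364988637148802824582337982519, 24, 354687650439053793445986676212875301023799,
  353956367348385265845480451885393632907319, 353988057905408382180171936204125582372927, 20, 30,
  40, 24, 354995612703898589330437185302135624683465, 354995612703898589330437185302135624683465,
  22654720090696601200805451212732499833958721, 30, 40, 24,
  354687445992389360581672233748744414490679, 24, 354687650439078165390510107137037377531959,
  353956367348360893900957020961231556399159, 353988057905401070596814906926876959420479, 26, 26,
  36, 353996030687692892280553340378566863622329, 26, 38,
  353995867130341848433483041667932493189305, 24, 36, 376098435067831448605089960691001931829059,
  376098435067829011410637617598585724178243, 24048527259189539965361431392939026235027383, 38,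
  376098353289155926681554811335684746612547, 376098353289153489487102468243268538961731,
  24048527381857553248246734116972002012852151, 22654725365421647732649075079866423818088509,
  420335144065308272560705752340891117055019, 34, 34, 22, 28,
  365387517187277072200630017661727098532029, 365387517187277072200630017661727098532029,
  22655070964680903072966507410728950946869437, 30, 365387517187269760617272988384478475579581,
  365387517187269760617272988384478475579581, 22655070964680893324188698038359286116266173, 24,
  26139216723436799055259156737382628470768805, 26139217050551501142953297334803897211634853, 24,
  23351628887329259691088321051153197241183287, 23351629009997272973973623775186173019008055,
  1539105401439575047772787090842230415148428861, 24, 23351963852784197489888292810532387888016439,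
  23351963975452210772773595534565363665841207, 1539105568922302516672187076721920010471845437,
  92793754924010276731616025252862495660743348673, 34, 22, 22,
  353985399397601826150417386234092296326459, 354320364852539624950389145613282943159611,
  22665787116448662087493159806635689952162243, 22, 353985399397609137733774415511340919278907,
  354320364852546936533746174890531566112059, 22665787116448662087493159806635689952162243, 22,
  353985399397601826150417386234092296326459, 353985399397609137733774415511340919278907,
  24048527172856829663903624420783648630623803, 22, 354320364852539624950389145613282943159611,
  354320364852546936533746174890531566112059, 24048862138311767462703596180162839277456955,
  1449913652622058294845969461115498771264573891, 23362685403902585604341417584722452709896255]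

/-- Refutation of a vertex all of whose cycles are longer than seven. -/
def largeGirthCert : List ℕ := [
  0, 2, 4, 6, 8, 10, 12, 14, 16, 36, 5876623741120354849809205085398385266233]

set_option maxRecDepth 10000 in
theorem refute_threeCycleCert : refute 1 threeCycleCert [cycle 3] = true := by decide +kernel

set_option maxRecDepth 10000 in
theorem refute_fourCycleCert : refute 2 fourCycleCert [cycle 4] = true := by decide +kernel

set_option maxRecDepth 10000 in
theorem refute_fiveCycleCert : refute 3 fiveCycleCert [cycle 5] = true := by decide +kernel

set_option maxRecDepth 10000 in
theorem refute_sixCycleCert : refute 4 sixCycleCert [cycle 6] = true := by decide +kernel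

set_option maxRecDepth 10000 in
theorem refute_sevenCycleCert : refute 5 sevenCycleCert [cycle 7] = true := by decide +kernel

set_option maxRecDepth 10000 in
theorem refute_largeGirthCert : refute 6 largeGirthCert [[[]]] = true := by decide +kernel

end PartialGraph

theorem stmt19 {V : Type*} [Fintype V] [DecidableEq V] (G : SimpleGraph V) [DecidableRel G.Adj]
    (hconn : G.Connected) (hreg : G.IsRegularOfDegree 3)
    (hlam : secondEigenvalue G ≤ 1.9) :
    Fintype.card V ≤ 18 := by
  by_contra! hcard
  obtain ⟨v⟩ := hconn.nonempty
  have hodd : Even (3 * Fintype.card V) := by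
    have := G.sum_degrees_eq_twice_card_edges
    simp only [hreg _, Finset.sum_const, Finset.card_univ, smul_eq_mul] at this
    exact ⟨G.edgeFinset.card, by omega⟩
  have hcard' : 20 ≤ Fintype.card V := by
    obtain ⟨k, hk⟩ := hodd
    omega
  have hQ : ∀ f : V → ℝ, 1000 * ∑ v, f v * ∑ w ∈ G.neighborFinset v, f w ≤
      1900 * ∑ v, f v * f v + 55 * ((∑ v, f v) * ∑ v, f v) := by
    intro f
    have : Nonempty V := ⟨v⟩
    have h₁ := sum_mul_sum_neighborFinset_le hreg (by norm_num) hlam f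
    have h₂ : (((3 : ℕ) : ℝ) - 1.9) / Fintype.card V ≤ 55 / 1000 := by
      have h₃ : (20 : ℝ) ≤ Fintype.card V := by exact_mod_cast hcard'
      rw [div_le_iff₀ (by linarith)]
      norm_num
      linarith
    have := mul_le_mul_of_nonneg_right h₂ (mul_self_nonneg (∑ v, f v))
    linarith
  have hm₁ : ∀ (v : V) (c : G.Walk v v), c.IsCycle → 2 < c.length := fun _ _ hc =>
    hc.three_le_length
  have hm₂ := PartialGraph.lt_length_of_refute hreg hQ hm₁ PartialGraph.refute_threeCycleCert
  have hm₃ := PartialGraph.lt_length_of_refute hreg hQ hm₂ PartialGraph.refute_fourCycleCert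
  have hm₄ := PartialGraph.lt_length_of_refute hreg hQ hm₃ PartialGraph.refute_fiveCycleCert
  have hm₅ := PartialGraph.lt_length_of_refute hreg hQ hm₄ PartialGraph.refute_sixCycleCert
  have hm₆ := PartialGraph.lt_length_of_refute hreg hQ hm₅ PartialGraph.refute_sevenCycleCert
  exact PartialGraph.Realizes.false_of_refute hreg hQ hm₆ PartialGraph.refute_largeGirthCert
    List.mem_cons_self (PartialGraph.realizes_singleton v)
end
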